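/- arXiv:0810.2207 — 3 statements merged into one kernel-verified Lean document; each statement's English description precedes it below -/
import Mathlib

section
/- Let Q be an LDP-polygon with maximal local index m_Q = k ≥ 2. Then the number of boundary lattice points satisfies |∂Q ∩ ℤ²| ≤ 4k(k + 2) − 2. -/
open Pointwise

/-- The embedding of the lattice `ℤ²` into `ℚ²`. -/
def toQ (p : ℤ × ℤ) : ℚ × ℚ := ((p.1 : ℚ), (p.2 : ℚ))

/-- The pairing between the dual lattice `ℤ²` and `ℚ²`. -/
def pairQ (η : ℤ × ℤ) (x : ℚ × ℚ) : ℚ := (η.1 : ℚ) * x.1 + (η.2 : ℚ) * x.2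

/-- A lattice polygon: the convex hull of finitely many lattice points,
with nonempty interior. -/
def IsLatticePolygon (Q : Set (ℚ × ℚ)) : Prop :=
  (∃ S : Finset (ℤ × ℤ), Q = convexHull ℚ (toQ '' (S : Set (ℤ × ℤ)))) ∧
    (interior Q).Nonempty

/-- An IP-polygon: a lattice polygon containing the origin in its interior. -/
def IsIPPolygon (Q : Set (ℚ × ℚ)) : Prop :=
  IsLatticePolygon Q ∧ (0 : ℚ × ℚ) ∈ interior Q

/-- The vertices of a polygon are its extreme points. -/
def vertices (Q : Set (ℚ × ℚ)) : Set (ℚ × ℚ) := Set.extremePoints ℚ Q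

/-- An LDP-polygon: an IP-polygon all of whose vertices are primitive lattice points. -/
def IsLDPPolygon (Q : Set (ℚ × ℚ)) : Prop :=
  IsIPPolygon Q ∧ ∀ v ∈ vertices Q, ∃ p : ℤ × ℤ, Int.gcd p.1 p.2 = 1 ∧ v = toQ p

/-- `IsFacetWith Q η l F` : `F` is a facet (edge) of `Q` with primitive outer normal
`η` and local index `l`, i.e. `⟨η, x⟩ = l` on `F` and `⟨η, y⟩ ≤ l` on `Q`. -/
def IsFacetWith (Q : Set (ℚ × ℚ)) (η : ℤ × ℤ) (l : ℤ) (F : Set (ℚ × ℚ)) : Prop :=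
  Int.gcd η.1 η.2 = 1 ∧ 0 < l ∧
  (∀ y ∈ Q, pairQ η y ≤ (l : ℚ)) ∧
  F = {x ∈ Q | pairQ η x = (l : ℚ)} ∧
  ∃ x ∈ F, ∃ y ∈ F, x ≠ y

/-- `F` is a facet of `Q`. -/
def IsFacet (Q F : Set (ℚ × ℚ)) : Prop := ∃ η l, IsFacetWith Q η l F

/-- `HasMaxLocalIndex Q k` : the maximal local index `m_Q` of `Q` equals `k`. -/
def HasMaxLocalIndex (Q : Set (ℚ × ℚ)) (k : ℤ) : Prop :=
  (∃ F η, IsFacetWith Q η k F) ∧ ∀ F η l, IsFacetWith Q η l F → l ≤ k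

/-- `HasIndex Q ℓ` : the index `ℓ_Q` of `Q` (the lcm of all local indices) equals `ℓ`. -/
def HasIndex (Q : Set (ℚ × ℚ)) (ℓ : ℤ) : Prop :=
  0 < ℓ ∧ (∀ F η l, IsFacetWith Q η l F → l ∣ ℓ) ∧
  ∀ m : ℤ, 0 < m → (∀ F η l, IsFacetWith Q η l F → l ∣ m) → ℓ ∣ m

/-- The only lattice point in the interior of `(1/k)·Q` is the origin. -/
def NoIntLatticePts (Q : Set (ℚ × ℚ)) (k : ℤ) : Prop :=
  ∀ p : ℤ × ℤ, toQ p ∈ interior (((k : ℚ)⁻¹) • Q) → p = 0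

/-- `HasOrder Q I` : the order `o_Q` of `Q` equals `I`. -/
def HasOrder (Q : Set (ℚ × ℚ)) (I : ℤ) : Prop :=
  1 ≤ I ∧ NoIntLatticePts Q I ∧ ∀ k : ℤ, 1 ≤ k → NoIntLatticePts Q k → I ≤ k

/-- The cone `pos(F) = ℝ≥0·F` spanned by `F` (inside `ℚ²`). -/
def posCone (F : Set (ℚ × ℚ)) : Set (ℚ × ℚ) :=
  {y | ∃ t : ℚ, 0 ≤ t ∧ ∃ z ∈ F, y = t • z}

/-- The number of lattice points in a subset of `ℚ²`. -/
noncomputable def latticeCount (S : Set (ℚ × ℚ)) : ℕ :=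
  {p : ℤ × ℤ | toQ p ∈ S}.ncard

/-- The normalised volume of `Q`: twice the Euclidean area of the corresponding
real region. -/
noncomputable def nVol (Q : Set (ℚ × ℚ)) : ℝ :=
  2 * (MeasureTheory.volume
    (closure ((fun x : ℚ × ℚ => ((x.1 : ℝ), (x.2 : ℝ))) '' Q))).toReal

/-- Unimodular equivalence: `Q'` is the image of `Q` under an element of `GL(2,ℤ)`. -/
def UnimodEquiv (Q Q' : Set (ℚ × ℚ)) : Prop :=
  ∃ a b c d : ℤ, (a * d - b * c = 1 ∨ a * d - b * c = -1) ∧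
    (fun x : ℚ × ℚ => ((a : ℚ) * x.1 + (b : ℚ) * x.2,
      (c : ℚ) * x.1 + (d : ℚ) * x.2)) '' Q = Q'


lemma sum_max_aux (D T : ℤ) (n : ℕ) :
    ∑ h ∈ Finset.Ico (-D) (-D + n), 2 * max (h + T) 0 ≤ 
      max (T - D + n) 0 * (max (T - D + n) 0 - 1) := by
  induction n with
  | zero => 
    simp only [Nat.cast_zero, add_zero, Finset.Ico_self, Finset.sum_empty]
    rcases le_or_gt (T - D) 0 with h | h
    · simp [max_eq_right h]
    · rw [max_eq_left h.le]; apply mul_nonneg <;> omega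
  | succ n ih =>
    have : Finset.Ico (-D) (-D + ((n + 1 : ℕ) : ℤ)) = insert (-D + (n:ℤ)) (Finset.Ico (-D) (-D + n)) := by
      ext x; simp only [Finset.mem_Ico, Finset.mem_insert]; push_cast; omega
    rw [this, Finset.sum_insert (by simp)]
    push_cast
    rcases le_or_gt 0 (T - D + n) with h | h
    · rw [max_eq_left h] at ih
      rw [max_eq_left (by omega : 0 ≤ -D + (n:ℤ) + T), max_eq_left (by omega : 0 ≤ T - D + ((n:ℤ)+1))]
      nlinarith
    · rw [max_eq_right h.le] at ih
      rw [max_eq_right (by omega : -D + (n:ℤ) + T ≤ 0), max_eq_right (by omega : T - D + ((n:ℤ)+1) ≤ 0)]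
      linarith

/-- cardinality of a horizontal slice versus its extent -/
lemma slice_ext (B : Finset (ℤ × ℤ)) (h : ℤ) (hne : (B.filter (fun p => p.2 = h)).Nonempty) :
    ∃ p ∈ B, ∃ q ∈ B, p.2 = h ∧ q.2 = h ∧
      ((B.filter (fun p => p.2 = h)).card : ℤ) ≤ p.1 - q.1 + 1 := by
  obtain ⟨p, hp, hpm⟩ := Finset.exists_max_image _ (fun p : ℤ × ℤ => p.1) hne
  obtain ⟨q, hq, hqm⟩ := Finset.exists_min_image _ (fun p : ℤ × ℤ => p.1) hne
  have hp' := Finset.mem_filter.1 hp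
  have hq' := Finset.mem_filter.1 hq
  refine ⟨p, hp'.1, q, hq'.1, hp'.2, hq'.2, ?_⟩
  have hc : (B.filter (fun p => p.2 = h)).card ≤ (Finset.Icc q.1 p.1).card := by
    apply Finset.card_le_card_of_injOn (fun p => p.1)
    · intro r hr
      have hr' : r ∈ B.filter (fun p => p.2 = h) := hr
      simp only [Finset.coe_Icc, Set.mem_Icc]
      exact ⟨hqm r hr', hpm r hr'⟩
    · intro r hr s hs hrs
      have h1 := (Finset.mem_filter.1 (Finset.mem_coe.1 hr)).2
      have h2 := (Finset.mem_filter.1 (Finset.mem_coe.1 hs)).2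
      exact Prod.ext hrs (h1.trans h2.symm)
  have := hpm q hq
  rw [Int.card_Icc] at hc
  omega

lemma comb (B : Finset (ℤ × ℤ)) (l D k : ℤ) (hl : 1 ≤ l) (hlk : l ≤ k) (hD : 1 ≤ D) (hk : 2 ≤ k)
    (h1 : ∀ p ∈ B, -D ≤ p.2 ∧ p.2 ≤ l)
    (h2 : ∀ h, -D < h → h < l → (B.filter (fun p => p.2 = h)).card ≤ 2)
    (h3 : 2 ≤ (B.filter (fun p => p.2 = -D)).card → D ≤ k)
    (h4 : 0 ≤ ∑ p ∈ B, p.2)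
    (h5 : ∀ p ∈ B, ∀ q ∈ B, p.2 = l → q.2 = -D →
      D * p.1 + l * q.1 ≤ k * (l + D) ∧ -(k * (l + D)) ≤ D * p.1 + l * q.1)
    (htop : ∃ p ∈ B, p.2 = l) (hbot : ∃ p ∈ B, p.2 = -D) :
    (B.card : ℤ) ≤ 4 * k * (k + 2) - 2 := by
  have htne : (B.filter (fun p => p.2 = l)).Nonempty := by
    obtain ⟨p, hp, h⟩ := htop; exact ⟨p, Finset.mem_filter.2 ⟨hp, h⟩⟩
  have hbne : (B.filter (fun p => p.2 = -D)).Nonempty := by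
    obtain ⟨p, hp, h⟩ := hbot; exact ⟨p, Finset.mem_filter.2 ⟨hp, h⟩⟩
  have ht1 : 1 ≤ (B.filter (fun p => p.2 = l)).card := htne.card_pos
  have hb1 : 1 ≤ (B.filter (fun p => p.2 = -D)).card := hbne.card_pos
  obtain ⟨p, hp, p', hp', e1, e2, hA⟩ := slice_ext B l htne
  obtain ⟨q, hq, q', hq', e3, e4, hB⟩ := slice_ext B (-D) hbne
  have i1 := (h5 p hp q hq e1 e3).1
  have i2 := (h5 p' hp' q' hq' e2 e4).2
  have hsplit : (B.filter (fun p => p.2 < l)).card + (B.filter (fun p => p.2 = l)).card = B.card := by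
    rw [← Finset.card_filter_add_card_filter_not (s := B) (fun p => p.2 < l)]
    congr 2
    apply Finset.filter_congr
    intro x hx
    have := h1 x hx
    constructor <;> intro h <;> omega
  set N := (B.filter (fun p => p.2 = l)).card with hN
  set M := (B.filter (fun p => p.2 = -D)).card with hM
  have hw : D * ((N:ℤ) - 1) + l * ((M:ℤ) - 1) ≤ 2 * (k * (l + D)) := by
    have a1 : D * ((N:ℤ) - 1) ≤ D * (p.1 - p'.1) := by
      apply mul_le_mul_of_nonneg_left <;> omega
    have a2 : l * ((M:ℤ) - 1) ≤ l * (q.1 - q'.1) := by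
      apply mul_le_mul_of_nonneg_left <;> omega
    linarith
  have hN1 : (0:ℤ) ≤ (N:ℤ) - 1 := by omega
  have hM1 : (0:ℤ) ≤ (M:ℤ) - 1 := by omega
  by_cases hDk : D ≤ k
  · have hAB : ((N:ℤ) - 1) + ((M:ℤ) - 1) ≤ 2 * k * (k + 1) := by
      rcases le_total D l with hc | hc
      · have : D * (((N:ℤ) - 1) + ((M:ℤ) - 1)) ≤ D * (2 * k * (k + 1)) := by
          have b1 : D * ((M:ℤ) - 1) ≤ l * ((M:ℤ) - 1) := mul_le_mul_of_nonneg_right hc hM1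
          have b2 : l ≤ k * D := by nlinarith
          have b3 : k * l ≤ k * (k * D) := mul_le_mul_of_nonneg_left b2 (by omega)
          nlinarith
        exact le_of_mul_le_mul_left this (by omega)
      · have : l * (((N:ℤ) - 1) + ((M:ℤ) - 1)) ≤ l * (2 * k * (k + 1)) := by
          have b1 : l * ((N:ℤ) - 1) ≤ D * ((N:ℤ) - 1) := mul_le_mul_of_nonneg_right hc hN1
          have b2 : D ≤ k * l := by nlinarith
          have b3 : k * D ≤ k * (k * l) := mul_le_mul_of_nonneg_left b2 (by omega)
          nlinarith
        exact le_of_mul_le_mul_left this (by omega)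
    have hmid : ((B.filter (fun p => p.2 < l)).filter (fun p => -D < p.2)).card ≤ 
        2 * (Finset.Ioo (-D) l).card := by
      apply Finset.card_le_mul_card_image_of_maps_to (f := fun p : ℤ × ℤ => p.2)
      · intro x hx
        simp only [Finset.mem_filter] at hx
        simp only [Finset.mem_Ioo]; omega
      · intro h hh
        rw [Finset.mem_Ioo] at hh
        refine le_trans (Finset.card_le_card ?_) (h2 h hh.1 hh.2)
        intro x hx
        simp only [Finset.mem_filter] at hx ⊢
        tauto
    have hs2 : ((B.filter (fun p => p.2 < l)).filter (fun p => -D < p.2)).card + M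
        = (B.filter (fun p => p.2 < l)).card := by
      rw [← Finset.card_filter_add_card_filter_not (s := B.filter (fun p => p.2 < l)) (fun p => -D < p.2), hM,
        Finset.filter_filter (fun p : ℤ × ℤ => p.2 < l) (fun p => ¬ -D < p.2)]
      congr 2
      apply Finset.filter_congr
      intro x hx
      have := h1 x hx
      constructor <;> intro h <;> omega
    rw [Int.card_Ioo] at hmid
    have : (B.card : ℤ) ≤ N + M + 2 * (l + D - 1) := by omega
    nlinarith
  · have hMle : M ≤ 1 := by
      by_contra hcon
      exact hDk (h3 (by omega))
    have hA2 : (N:ℤ) - 1 ≤ 2 * k * (k + 1) := by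
      have : D * ((N:ℤ) - 1) ≤ D * (2 * k * (k + 1)) := by
        have b1 : 0 ≤ l * ((M:ℤ) - 1) := mul_nonneg (by omega) hM1
        have b2 : l ≤ k * D := by nlinarith
        have b3 : k * l ≤ k * (k * D) := mul_le_mul_of_nonneg_left b2 (by omega)
        nlinarith
      exact le_of_mul_le_mul_left this (by omega)
    set C := B.filter (fun p => p.2 < l) with hC
    have hsum : ∑ p ∈ B, p.2 = ∑ p ∈ C, p.2 + l * N := by
      rw [← Finset.sum_filter_add_sum_filter_not B (fun p => p.2 < l)]
      congr 1
      have : B.filter (fun p => ¬ p.2 < l) = B.filter (fun p => p.2 = l) := by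
        apply Finset.filter_congr
        intro x hx
        have := h1 x hx
        constructor <;> intro h <;> omega
      rw [this, Finset.sum_congr rfl (g := fun _ => l) (fun x hx => (Finset.mem_filter.1 hx).2)]
      simp [hN, mul_comm]
    have hg : ∑ p ∈ C, (p.2 + 2 * k) ≤ (2 * k + l) * (2 * k + l - 1) := by
      calc ∑ p ∈ C, (p.2 + 2 * k) ≤ ∑ p ∈ C, max (p.2 + 2 * k) 0 :=
            Finset.sum_le_sum (fun _ _ => le_max_left _ _)
        _ = ∑ h ∈ Finset.Ico (-D) l, ∑ p ∈ C.filter (fun p => p.2 = h), max (p.2 + 2 * k) 0 := by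
            rw [Finset.sum_fiberwise_of_maps_to]
            intro x hx
            have hx' := Finset.mem_filter.1 hx
            have := h1 x hx'.1
            simp only [Finset.mem_Ico]
            omega
        _ ≤ ∑ h ∈ Finset.Ico (-D) l, 2 * max (h + 2 * k) 0 := by
            apply Finset.sum_le_sum
            intro h hh
            rw [Finset.mem_Ico] at hh
            rw [Finset.sum_congr rfl (g := fun _ => max (h + 2 * k) 0)
              (fun x hx => by rw [(Finset.mem_filter.1 hx).2])]
            rw [Finset.sum_const, nsmul_eq_mul]
            apply mul_le_mul_of_nonneg_right _ (le_max_right _ _)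
            have hle : (C.filter (fun p => p.2 = h)).card ≤ (B.filter (fun p => p.2 = h)).card := by
              apply Finset.card_le_card
              intro x hx
              simp only [hC, Finset.mem_filter] at hx ⊢
              tauto
            rcases eq_or_lt_of_le hh.1 with he | hlt
            · subst he; omega
            · have := h2 h hlt hh.2
              omega
        _ ≤ _ := by
            have := sum_max_aux D (2 * k) (l + D).toNat
            rw [Int.toNat_of_nonneg (by omega)] at this
            have e : -D + (l + D) = l := by ring
            have e' : 2 * k - D + (l + D) = 2 * k + l := by ring
            rw [e, e', max_eq_left (by omega)] at this
            exact this
    rw [Finset.sum_add_distrib, Finset.sum_const, nsmul_eq_mul] at hg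
    have hc1 : (C.card : ℤ) + N = B.card := by exact_mod_cast hsplit
    have c1 : (2 * k + l) * (2 * k + l - 1) ≤ (3 * k) * (3 * k - 1) := by
      apply mul_le_mul <;> omega
    have c2 : l * (N:ℤ) ≤ k * (2 * k * (k + 1) + 1) := by
      apply mul_le_mul <;> omega
    have c3 : (C.card : ℤ) * (2 * k) ≤ (3 * k) * (3 * k - 1) + k * (2 * k * (k + 1) + 1) := by
      linarith
    have c4 : k * ((C.card : ℤ) * 2) ≤ k * (3 * (3 * k - 1) + (2 * k * (k + 1) + 1)) := by
      linarith
    have c5 := le_of_mul_le_mul_left c4 (by omega)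
    have c6 : 2 * 2 ≤ k * k := by apply mul_le_mul <;> omega
    linarith

lemma pairQ_add (η : ℤ × ℤ) (x y : ℚ × ℚ) : pairQ η (x + y) = pairQ η x + pairQ η y := by
  simp only [pairQ, Prod.fst_add, Prod.snd_add]; ring

lemma pairQ_smul (η : ℤ × ℤ) (c : ℚ) (x : ℚ × ℚ) : pairQ η (c • x) = c * pairQ η x := by
  simp only [pairQ, Prod.smul_fst, Prod.smul_snd, smul_eq_mul]; ring

/-- A linear functional with rational coefficients bounded by `c` on the generators
is bounded by `c` on the hull. -/
lemma hull_le (S : Set (ℚ × ℚ)) (α β c : ℚ) (h : ∀ p ∈ S, α * p.1 + β * p.2 ≤ c) :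
    ∀ y ∈ convexHull ℚ S, α * y.1 + β * y.2 ≤ c := by
  have : convexHull ℚ S ⊆ {y : ℚ × ℚ | α * y.1 + β * y.2 ≤ c} := by
    refine convexHull_min (fun p hp => h p hp) ?_
    intro x hx y hy a b ha hb hab
    replace hx : α * x.1 + β * x.2 ≤ c := hx
    replace hy : α * y.1 + β * y.2 ≤ c := hy
    show α * (a • x + b • y).1 + β * (a • x + b • y).2 ≤ c
    simp only [Prod.fst_add, Prod.snd_add, Prod.smul_fst, Prod.smul_snd,
      smul_eq_mul]
    have : c = a * c + b * c := by rw [← add_mul, hab, one_mul]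
    nlinarith [mul_le_mul_of_nonneg_left hx ha, mul_le_mul_of_nonneg_left hy hb]
  exact this

lemma closure_le (Q : Set (ℚ × ℚ)) (α β c : ℚ) (h : ∀ p ∈ Q, α * p.1 + β * p.2 ≤ c) :
    ∀ y ∈ closure Q, α * y.1 + β * y.2 ≤ c := by
  have : closure Q ⊆ {y : ℚ × ℚ | α * y.1 + β * y.2 ≤ c} := by
    refine closure_minimal (fun p hp => h p hp) ?_
    have hc : Continuous (fun y : ℚ × ℚ => α * y.1 + β * y.2) := by fun_prop
    exact isClosed_le hc continuous_const
  exact this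

lemma interior_move (Q : Set (ℚ × ℚ)) (y z : ℚ × ℚ) (hy : y ∈ interior Q) :
    ∃ δ : ℚ, 0 < δ ∧ y + δ • z ∈ Q := by
  have hcont : Continuous (fun δ : ℚ => ((y.1 + δ * z.1, y.2 + δ * z.2) : ℚ × ℚ)) := by fun_prop
  have hopen : IsOpen ((fun δ : ℚ => ((y.1 + δ * z.1, y.2 + δ * z.2) : ℚ × ℚ)) ⁻¹' interior Q) :=
    isOpen_interior.preimage hcont
  rw [Metric.isOpen_iff] at hopen
  obtain ⟨ε, hε, hb⟩ := hopen 0 (by simpa using hy)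
  obtain ⟨δ, h0, h1⟩ := exists_rat_btwn hε
  have h0' : (0:ℚ) < δ := by exact_mod_cast h0
  refine ⟨δ, h0', interior_subset ?_⟩
  have := hb (show δ ∈ Metric.ball (0:ℚ) ε by
    rw [Metric.mem_ball, Rat.dist_eq]
    simp only [Rat.cast_zero, sub_zero]
    rw [abs_of_pos h0]; exact h1)
  exact this

/-- A functional bounded above by its value at `y` vanishes if `y` is interior. -/
lemma not_interior (Q : Set (ℚ × ℚ)) (α β : ℚ) (hne : α ≠ 0 ∨ β ≠ 0) (y : ℚ × ℚ)
    (h : ∀ p ∈ Q, α * p.1 + β * p.2 ≤ α * y.1 + β * y.2) : y ∉ interior Q := by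
  intro hy
  obtain ⟨δ, hδ, hm⟩ := interior_move Q y (α, β) hy
  have := h _ hm
  simp only [Prod.fst_add, Prod.snd_add, Prod.smul_fst, Prod.smul_snd, smul_eq_mul] at this
  have h2 : 0 < α * α + β * β := by
    rcases hne with h | h
    · have := mul_self_pos.2 h; nlinarith [mul_self_nonneg β]
    · have := mul_self_pos.2 h; nlinarith [mul_self_nonneg α]
  nlinarith [mul_pos hδ h2]

/-- Turn an integral supporting functional into a facet. -/
lemma mk_facet (Q : Set (ℚ × ℚ)) (η : ℤ × ℤ) (hη : η ≠ 0) (p : ℤ × ℤ)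
    (hp : toQ p ∈ Q) (hpos : 0 < pairQ η (toQ p))
    (hle : ∀ y ∈ Q, pairQ η y ≤ pairQ η (toQ p))
    (z : ℚ × ℚ) (hz : z ∈ Q) (hzp : pairQ η z = pairQ η (toQ p)) (hne : z ≠ toQ p) :
    ∃ η' l F, IsFacetWith Q η' l F ∧ z ∈ F := by
  have hg : 0 < Int.gcd η.1 η.2 := by
    rw [Nat.pos_iff_ne_zero]
    intro h
    rw [Int.gcd_eq_zero_iff] at h
    exact hη (Prod.ext h.1 h.2)
  obtain ⟨a, b, hab, ha, hb⟩ := Int.exists_gcd_one hg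
  set g : ℤ := (Int.gcd η.1 η.2 : ℤ) with hgd
  have hg' : (0:ℚ) < (g:ℚ) := by rw [hgd]; exact_mod_cast hg
  have key : ∀ y, pairQ η y = g * pairQ (a, b) y := by
    intro y
    simp only [pairQ]
    rw [ha, hb]; push_cast; ring
  have hl : pairQ (a, b) (toQ p) = ((a * p.1 + b * p.2 : ℤ) : ℚ) := by
    simp [pairQ, toQ]
  refine ⟨(a, b), a * p.1 + b * p.2, _, ⟨hab, ?_, ?_, rfl, ?_⟩, ?_⟩
  · rw [key, hl] at hpos
    have := pos_of_mul_pos_right hpos hg'.le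
    exact_mod_cast this
  · intro y hy
    have := hle y hy
    rw [key, key] at this
    rw [← hl]
    exact le_of_mul_le_mul_left this hg'
  · refine ⟨toQ p, ⟨hp, hl⟩, z, ⟨hz, ?_⟩, hne.symm⟩
    rw [key, key] at hzp
    rw [← hl]; exact mul_left_cancel₀ hg'.ne' hzp
  · refine ⟨hz, ?_⟩
    rw [key, key] at hzp
    rw [← hl]; exact mul_left_cancel₀ hg'.ne' hzp

/-- The ray through a nonzero lattice point hits a facet. -/
lemma facet_exists (S : Finset (ℤ × ℤ)) (Q : Set (ℚ × ℚ))
    (hQ : Q = convexHull ℚ (toQ '' (S : Set (ℤ × ℤ)))) (h0 : (0 : ℚ × ℚ) ∈ interior Q)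
    (x : ℤ × ℤ) (hx : x ≠ 0) :
    ∃ η l F, IsFacetWith Q η l F ∧ ∃ μ : ℚ, 0 < μ ∧ μ • toQ x ∈ F := by
  have hSQ : ∀ p ∈ S, toQ p ∈ Q := by
    intro p hp; rw [hQ]; exact subset_convexHull _ _ ⟨p, hp, rfl⟩
  have hconv : Convex ℚ Q := by rw [hQ]; exact convex_convexHull _ _
  have hSle : ∀ (α β c : ℚ), (∀ p ∈ S, α * (p.1:ℚ) + β * (p.2:ℚ) ≤ c) →
      ∀ y ∈ Q, α * y.1 + β * y.2 ≤ c := by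
    intro α β c h
    rw [hQ]
    apply hull_le
    rintro _ ⟨p, hp, rfl⟩
    exact h p hp
  have hxne : (x.1 : ℚ) ≠ 0 ∨ (x.2 : ℚ) ≠ 0 := by
    by_contra hcon
    push Not at hcon
    exact hx (Prod.ext (by exact_mod_cast hcon.1) (by exact_mod_cast hcon.2))
  -- there are generators on both sides of the line spanned by `x`
  let a : ℤ × ℤ → ℚ := fun p => (x.1:ℚ) * p.1 + (x.2:ℚ) * p.2
  let b : ℤ × ℤ → ℚ := fun p => -(x.2:ℚ) * p.1 + (x.1:ℚ) * p.2
  have hxx : 0 < (x.1:ℚ) * x.1 + (x.2:ℚ) * x.2 := by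
    rcases hxne with h | h
    · have := mul_self_pos.2 h; nlinarith [mul_self_nonneg (x.2:ℚ)]
    · have := mul_self_pos.2 h; nlinarith [mul_self_nonneg (x.1:ℚ)]
  have hP : ∃ p ∈ S, 0 < b p := by
    by_contra hcon
    push Not at hcon
    have h1 := hSle _ _ 0 hcon
    refine not_interior Q (-(x.2:ℚ)) (x.1:ℚ) ?_ 0 ?_ h0
    · rcases hxne with h | h
      · exact Or.inr h
      · exact Or.inl (neg_ne_zero.2 h)
    · intro p hp; simpa using h1 p hp
  have hN : ∃ p ∈ S, b p < 0 := by
    by_contra hcon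
    push Not at hcon
    have h1 := hSle (x.2:ℚ) (-(x.1:ℚ)) 0 (by
      intro p hp
      have := hcon p hp
      simp only [b] at this
      linarith)
    refine not_interior Q (x.2:ℚ) (-(x.1:ℚ)) ?_ 0 ?_ h0
    · rcases hxne with h | h
      · exact Or.inr (neg_ne_zero.2 h)
      · exact Or.inl h
    · intro p hp; simpa using h1 p hp
  -- maximal crossing
  let cr : (ℤ × ℤ) × (ℤ × ℤ) → ℚ := fun r => (b r.1 * a r.2 - b r.2 * a r.1) / (b r.1 - b r.2)
  obtain ⟨⟨p1, q1⟩, hpq, hmax⟩ := Finset.exists_max_image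
    ((S.filter (fun p => 0 ≤ b p)) ×ˢ (S.filter (fun p => b p < 0))) cr (by
      obtain ⟨p, hp, hp'⟩ := hP
      obtain ⟨q, hq, hq'⟩ := hN
      exact ⟨(p, q), by simp [hp, hq, hp'.le, hq']⟩)
  simp only [Finset.mem_product, Finset.mem_filter] at hpq hmax
  obtain ⟨⟨hp1, hbp1⟩, hq1, hbq1⟩ := hpq
  set c := cr (p1, q1) with hc
  have hmax' : ∀ p ∈ S, ∀ q ∈ S, 0 ≤ b p → b q < 0 →
      b p * a q - b q * a p ≤ c * (b p - b q) := by
    intro p hp q hq h1 h2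
    have := hmax (p, q) ⟨⟨hp, h1⟩, hq, h2⟩
    exact (div_le_iff₀ (by linarith)).1 this
  -- slope
  obtain ⟨p0, hp0, hmin⟩ := Finset.exists_min_image (S.filter (fun p => 0 < b p))
    (fun p => (c - a p) / b p) (by
      obtain ⟨p, hp, hp'⟩ := hP
      exact ⟨p, by simp [hp, hp']⟩)
  simp only [Finset.mem_filter] at hp0 hmin
  obtain ⟨hp0, hbp0⟩ := hp0
  set t := (c - a p0) / b p0 with ht
  have htp0 : a p0 + t * b p0 = c := by
    rw [ht, div_mul_cancel₀ _ hbp0.ne']; ring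
  have hall : ∀ p ∈ S, a p + t * b p ≤ c := by
    intro p hp
    rcases lt_trichotomy (b p) 0 with h | h | h
    · have h1 := hmax' p0 hp0 p hp hbp0.le h
      -- b p0 * a p - b p * a p0 ≤ c (b p0 - b p)
      have h2 : b p0 * (a p + t * b p) ≤ b p0 * c := by
        have : a p0 = c - t * b p0 := by linarith
        rw [this] at h1
        nlinarith
      exact le_of_mul_le_mul_left h2 hbp0
    · have h1 := hmax' p hp q1 hq1 h.ge hbq1
      rw [h] at h1 ⊢
      have h2 : (-b q1) * a p ≤ (-b q1) * c := by linarith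
      have := le_of_mul_le_mul_left h2 (by linarith)
      linarith
    · have h1 := hmin p ⟨hp, h⟩
      rw [le_div_iff₀ h] at h1
      linarith
  -- functional with rational coefficients
  have hfun : ∀ y ∈ Q, ((x.1:ℚ) - t * x.2) * y.1 + ((x.2:ℚ) + t * x.1) * y.2 ≤ c := by
    apply hSle
    intro p hp
    have := hall p hp
    simp only [a, b] at this
    linarith
  have hnz : (x.1:ℚ) - t * x.2 ≠ 0 ∨ (x.2:ℚ) + t * x.1 ≠ 0 := by
    by_contra hcon
    push Not at hcon
    have : (x.1:ℚ) * x.1 + (x.2:ℚ) * x.2 = 0 := by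
      linear_combination (x.1:ℚ) * hcon.1 + (x.2:ℚ) * hcon.2
    linarith
  have hcpos : 0 < c := by
    by_contra hcon
    push Not at hcon
    refine not_interior Q _ _ hnz 0 ?_ h0
    intro p hp
    have := hfun p hp
    simp only [Prod.fst_zero, Prod.snd_zero, mul_zero, add_zero]
    linarith
  -- the crossing point
  set n : ℚ := (x.1:ℚ) * x.1 + (x.2:ℚ) * x.2 with hn
  have hzQ : (c / n) • toQ x ∈ Q := by
    have hd : 0 < b p1 - b q1 := by linarith
    have := hconv (hSQ p1 hp1) (hSQ q1 hq1) (a := -b q1 / (b p1 - b q1)) (b := b p1 / (b p1 - b q1))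
      (div_nonneg (by linarith) hd.le) (div_nonneg hbp1 hd.le) (by field_simp; ring)
    convert this using 1
    have hcc : c = (b p1 * a q1 - b q1 * a p1) / (b p1 - b q1) := rfl
    rw [hcc]
    have hd' := hd.ne'
    have hn' := hxx.ne'
    ext
    · simp only [toQ, Prod.fst_add, Prod.smul_fst, smul_eq_mul]
      field_simp
      simp only [a, b, hn]
      ring
    · simp only [toQ, Prod.snd_add, Prod.smul_snd, smul_eq_mul]
      field_simp
      simp only [a, b, hn]
      ring
  have htd : (t.den : ℚ) * t = t.num := by
    rw [mul_comm]; exact Rat.mul_den_eq_num t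
  have hden : (0:ℚ) < t.den := by exact_mod_cast t.den_pos
  let η : ℤ × ℤ := (t.den * x.1 - t.num * x.2, t.den * x.2 + t.num * x.1)
  have hη : ∀ y, pairQ η y = t.den * (((x.1:ℚ) - t * x.2) * y.1 + ((x.2:ℚ) + t * x.1) * y.2) := by
    intro y
    simp only [pairQ, η]
    push_cast
    rw [← htd]
    ring
  have hηp : pairQ η (toQ p0) = t.den * c := by
    rw [hη, ← htp0]
    simp only [a, b, toQ]
    ring
  obtain ⟨η', l, F, hF, hzF⟩ := mk_facet Q η (by
      intro h
      have h3 : pairQ η (toQ p0) = 0 := by rw [h]; simp [pairQ]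
      rw [hηp] at h3
      have := mul_pos hden hcpos
      linarith) p0 (hSQ p0 hp0) (by rw [hηp]; exact mul_pos hden hcpos) (by
      intro y hy
      rw [hηp, hη]
      exact mul_le_mul_of_nonneg_left (hfun y hy) hden.le) ((c / n) • toQ x) hzQ (by
      rw [hηp, hη]
      simp only [toQ, Prod.smul_fst, Prod.smul_snd, smul_eq_mul]
      have hn' := hxx.ne'
      field_simp
      simp only [hn]
      ring) (by
      intro h
      have hb0 : b p0 = 0 := by
        have e1 : c / n * (x.1:ℚ) = p0.1 := congrArg Prod.fst h
        have e2 : c / n * (x.2:ℚ) = p0.2 := congrArg Prod.snd h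
        simp only [b]
        rw [← e1, ← e2]; ring
      linarith)
  exact ⟨η', l, F, hF, c / n, div_pos hcpos hxx, hzF⟩

lemma pairQ_toQ (η p : ℤ × ℤ) : pairQ η (toQ p) = ((η.1 * p.1 + η.2 * p.2 : ℤ) : ℚ) := by
  simp [pairQ, toQ]

lemma ne_of_gcd {η : ℤ × ℤ} (h : Int.gcd η.1 η.2 = 1) : (η.1 : ℚ) ≠ 0 ∨ (η.2 : ℚ) ≠ 0 := by
  by_contra hcon
  push Not at hcon
  have h1 : η.1 = 0 := by exact_mod_cast hcon.1
  have h2 : η.2 = 0 := by exact_mod_cast hcon.2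
  rw [h1, h2] at h
  simp at h

/-- Frontier lattice points lie in `Q`, on some facet. -/
lemma frontier_facet (S : Finset (ℤ × ℤ)) (Q : Set (ℚ × ℚ))
    (hQ : Q = convexHull ℚ (toQ '' (S : Set (ℤ × ℤ)))) (h0 : (0 : ℚ × ℚ) ∈ interior Q)
    (x : ℤ × ℤ) (hx : toQ x ∈ frontier Q) :
    ∃ η l F, IsFacetWith Q η l F ∧ toQ x ∈ F := by
  have hconv : Convex ℚ Q := by rw [hQ]; exact convex_convexHull _ _
  have hx0 : x ≠ 0 := by
    rintro rfl
    apply hx.2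
    have : toQ 0 = 0 := by simp [toQ]
    rw [this]; exact h0
  obtain ⟨η, l, F, hF, μ, hμ, hm⟩ := facet_exists S Q hQ h0 x hx0
  refine ⟨η, l, F, hF, ?_⟩
  obtain ⟨hg, hl, hle, hFe, -⟩ := hF
  rw [hFe] at hm
  obtain ⟨hmQ, hml⟩ := hm
  have hc : pairQ η (toQ x) ≤ l := closure_le Q η.1 η.2 l hle _ hx.1
  rw [pairQ_smul] at hml
  have hl' : (0:ℚ) < l := by exact_mod_cast hl
  have hμ1 : 1 ≤ μ := by
    by_contra hcon
    push Not at hcon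
    have hpos : 0 < pairQ η (toQ x) := by
      by_contra h
      push Not at h
      have := mul_nonpos_of_nonneg_of_nonpos hμ.le h
      linarith
    nlinarith
  rcases eq_or_lt_of_le hμ1 with h1 | h1
  · rw [← h1, one_smul] at hmQ
    rw [← h1, one_mul] at hml
    rw [hFe]
    exact ⟨hmQ, hml⟩
  · exfalso
    apply hx.2
    have hmi : (0:ℚ) < 1 - μ⁻¹ := by
      have := inv_lt_one_of_one_lt₀ h1
      linarith
    have := hconv.combo_interior_self_mem_interior h0 hmQ hmi (inv_pos.2 hμ).le (by ring)
    rw [smul_zero, zero_add, smul_smul, inv_mul_cancel₀ hμ.ne', one_smul] at this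
    exact this

lemma three_sorted (C : Finset (ℤ × ℤ)) (h : ℤ) (hC : ∀ p ∈ C, p.2 = h) (hc : 2 < C.card) :
    ∃ p ∈ C, ∃ q ∈ C, ∃ r ∈ C, p.1 < q.1 ∧ q.1 < r.1 := by
  obtain ⟨p, hp, q, hq, r, hr, h1, h2, h3⟩ := Finset.two_lt_card.1 hc
  have e1 : p.1 ≠ q.1 := fun h => h1 (Prod.ext h ((hC p hp).trans (hC q hq).symm))
  have e2 : p.1 ≠ r.1 := fun h => h2 (Prod.ext h ((hC p hp).trans (hC r hr).symm))
  have e3 : q.1 ≠ r.1 := fun h => h3 (Prod.ext h ((hC q hq).trans (hC r hr).symm))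
  rcases lt_or_gt_of_ne e1 with a | a <;> rcases lt_or_gt_of_ne e2 with b | b <;>
    rcases lt_or_gt_of_ne e3 with c | c
  · exact ⟨p, hp, q, hq, r, hr, a, c⟩
  · exact ⟨p, hp, r, hr, q, hq, b, c⟩
  · omega
  · exact ⟨r, hr, p, hp, q, hq, b, a⟩
  · exact ⟨q, hq, p, hp, r, hr, a, b⟩
  · omega
  · exact ⟨q, hq, r, hr, p, hp, c, b⟩
  · exact ⟨r, hr, q, hq, p, hp, c, a⟩

/-- Bound along a primitive direction. -/
lemma dir_bound (S : Finset (ℤ × ℤ)) (Q : Set (ℚ × ℚ)) (k : ℤ)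
    (hQ : Q = convexHull ℚ (toQ '' (S : Set (ℤ × ℤ)))) (h0 : (0 : ℚ × ℚ) ∈ interior Q)
    (hmax : ∀ F η l, IsFacetWith Q η l F → l ≤ k) (e : ℤ × ℤ) (he : e ≠ 0) (c : ℚ)
    (hc : c • toQ e ∈ Q) : c ≤ k := by
  obtain ⟨η, l, F, hF, μ, hμ, hm⟩ := facet_exists S Q hQ h0 e he
  have hlk := hmax _ _ _ hF
  obtain ⟨hg, hl, hle, hFe, -⟩ := hF
  rw [hFe] at hm
  have hml := hm.2
  have hcl := hle _ hc
  rw [pairQ_smul, pairQ_toQ] at hml hcl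
  set m : ℤ := η.1 * e.1 + η.2 * e.2
  have hl' : (0:ℚ) < l := by exact_mod_cast hl
  have hlk' : (l:ℚ) ≤ k := by exact_mod_cast hlk
  have hmpos : (0:ℚ) < m := by
    by_contra h
    push Not at h
    have := mul_nonpos_of_nonneg_of_nonpos hμ.le h
    linarith
  have hm1 : (1:ℚ) ≤ m := by
    have : 0 < m := by exact_mod_cast hmpos
    exact_mod_cast this
  rcases le_or_gt c 0 with h | h
  · linarith
  · nlinarith

lemma slice_arith {α β m h l D A B C P R : ℤ} (hm : 0 < m) (hab : A < B) (hbc : B < C)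
    (hh1 : -D < h) (hh2 : h < l) (i1 : α * A + β * h ≤ m) (hbv : α * B + β * h = m)
    (i2 : α * C + β * h ≤ m) (i3 : α * P + β * l ≤ m) (i4 : α * R + β * (-D) ≤ m) : False := by
  have hα : α = 0 := by
    rcases lt_trichotomy α 0 with h | h | h
    · have := mul_lt_mul_of_neg_left hab h
      linarith
    · exact h
    · have := mul_lt_mul_of_pos_left hbc h
      linarith
  subst hα
  rcases lt_trichotomy β 0 with hβ | hβ | hβ
  · have := mul_lt_mul_of_neg_left hh1 hβ
    linarith
  · subst hβ; linarith
  · have := mul_lt_mul_of_pos_left hh2 hβ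
    linarith

set_option maxHeartbeats 1000000 in
/-- If `Q` is an LDP-polygon of maximal local index `m_Q = k ≥ 2`, then
`|∂Q ∩ ℤ²| ≤ 4k(k + 2) − 2`. -/
theorem boundary_lattice_points_bound_LDP
    (Q : Set (ℚ × ℚ)) (k : ℤ) (hQ : IsLDPPolygon Q) (hk : 2 ≤ k)
    (hmax : HasMaxLocalIndex Q k) :
    (latticeCount (frontier Q) : ℤ) ≤ 4 * k * (k + 2) - 2 := by
  by_cases hfin : {p : ℤ × ℤ | toQ p ∈ frontier Q}.Finite
  swap
  · have : latticeCount (frontier Q) = 0 := Set.Infinite.ncard hfin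
    rw [this]
    push_cast
    nlinarith
  obtain ⟨⟨⟨⟨S, hS⟩, -⟩, h0⟩, -⟩ := hQ
  obtain ⟨⟨F₀, η₀, hF₀⟩, hmx⟩ := hmax
  set B := hfin.toFinset with hB
  have hmemB : ∀ p, p ∈ B ↔ toQ p ∈ frontier Q := by intro p; simp [hB]
  have hcard : latticeCount (frontier Q) = B.card := Set.ncard_eq_toFinset_card _ hfin
  have hSQ : ∀ p ∈ S, toQ p ∈ Q := by
    intro p hp; rw [hS]; exact subset_convexHull _ _ ⟨p, hp, rfl⟩
  have hconv : Convex ℚ Q := by rw [hS]; exact convex_convexHull _ _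
  have hSle : ∀ (α β c : ℚ), (∀ p ∈ S, α * (p.1:ℚ) + β * (p.2:ℚ) ≤ c) →
      ∀ y ∈ Q, α * y.1 + β * y.2 ≤ c := by
    intro α β c h
    rw [hS]
    apply hull_le
    rintro _ ⟨p, hp, rfl⟩
    exact h p hp
  have hBQ : ∀ p ∈ B, toQ p ∈ Q := by
    intro p hp
    obtain ⟨η, l, F, hF, hm⟩ := frontier_facet S Q hS h0 p ((hmemB p).1 hp)
    rw [hF.2.2.2.1] at hm
    exact hm.1
  -- special facet
  obtain ⟨η, l, F, hF, hsum⟩ : ∃ η l F, IsFacetWith Q η l F ∧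
      0 ≤ ∑ p ∈ B, (η.1 * p.1 + η.2 * p.2) := by
    have hlin : ∀ η : ℤ × ℤ, ∑ p ∈ B, (η.1 * p.1 + η.2 * p.2) =
        η.1 * (∑ p ∈ B, p).1 + η.2 * (∑ p ∈ B, p).2 := by
      intro η
      rw [Finset.sum_add_distrib, Prod.fst_sum, Prod.snd_sum, Finset.mul_sum, Finset.mul_sum]
    by_cases hs : (∑ p ∈ B, p) = 0
    · refine ⟨η₀, k, F₀, hF₀, ?_⟩
      rw [hlin, hs]; simp
    · obtain ⟨η, l, F, hF, μ, hμ, hm⟩ := facet_exists S Q hS h0 _ hs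
      refine ⟨η, l, F, hF, ?_⟩
      rw [hlin]
      rw [hF.2.2.2.1] at hm
      have hml := hm.2
      rw [pairQ_smul, pairQ_toQ] at hml
      have hl : (0:ℚ) < l := by exact_mod_cast hF.2.1
      by_contra h
      push Not at h
      have h' : ((η.1 * (∑ p ∈ B, p).1 + η.2 * (∑ p ∈ B, p).2 : ℤ) : ℚ) < 0 := by exact_mod_cast h
      have := mul_neg_of_pos_of_neg hμ h'
      linarith
  have hlk := hmx _ _ _ hF
  obtain ⟨hg, hl, hle, hFe, x1, hx1, -⟩ := hF
  have hηne := ne_of_gcd hg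
  -- heights
  have hleZ : ∀ p, toQ p ∈ Q → η.1 * p.1 + η.2 * p.2 ≤ l := by
    intro p hp
    have := hle _ hp
    rw [pairQ_toQ] at this
    exact_mod_cast this
  have htop : ∃ p ∈ S, η.1 * p.1 + η.2 * p.2 = l := by
    by_contra hcon
    push Not at hcon
    rw [hFe] at hx1
    have h1 := hSle η.1 η.2 (l - 1) (by
      intro p hp
      have h2 := hleZ p (hSQ p hp)
      have h3 := hcon p hp
      have h4 : η.1 * p.1 + η.2 * p.2 ≤ l - 1 := by omega
      exact_mod_cast h4) x1 hx1.1
    have h2 := hx1.2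
    simp only [pairQ] at h2
    linarith
  have hSne : S.Nonempty := by
    obtain ⟨p, hp, -⟩ := htop; exact ⟨p, hp⟩
  obtain ⟨p₀, hp₀, htop⟩ := htop
  obtain ⟨q₀, hq₀, hbot⟩ := Finset.exists_min_image S (fun p => η.1 * p.1 + η.2 * p.2) hSne
  obtain ⟨D, hD⟩ : ∃ D : ℤ, η.1 * q₀.1 + η.2 * q₀.2 = -D := ⟨_, (neg_neg _).symm⟩
  have hneg : ∀ y ∈ Q, -(η.1:ℚ) * y.1 + -(η.2:ℚ) * y.2 ≤ D := by
    apply hSle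
    intro p hp
    have h1 := hbot p hp
    simp only [hD] at h1
    have h2 : -η.1 * p.1 + -η.2 * p.2 ≤ D := by linarith
    exact_mod_cast h2
  have hnegne : -(η.1:ℚ) ≠ 0 ∨ -(η.2:ℚ) ≠ 0 := by
    rcases hηne with h | h
    · exact Or.inl (neg_ne_zero.2 h)
    · exact Or.inr (neg_ne_zero.2 h)
  have hD1 : 1 ≤ D := by
    by_contra hcon
    have hD0 : (D:ℚ) ≤ 0 := by
      have : D ≤ 0 := by omega
      exact_mod_cast this
    refine not_interior Q _ _ hnegne 0 ?_ h0
    intro p hp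
    have := hneg p hp
    simp only [Prod.fst_zero, Prod.snd_zero, mul_zero, add_zero]
    linarith
  have hp₀B : p₀ ∈ B := by
    rw [hmemB]
    refine ⟨subset_closure (hSQ _ hp₀), ?_⟩
    refine not_interior Q η.1 η.2 hηne _ ?_
    intro y hy
    have h1 := hle y hy
    have h2 := pairQ_toQ η p₀
    rw [htop] at h2
    simp only [pairQ] at h1 h2
    linarith
  have hDq : pairQ η (toQ q₀) = -(D:ℚ) := by rw [pairQ_toQ, hD]; push_cast; ring
  have hq₀B : q₀ ∈ B := by
    rw [hmemB]
    refine ⟨subset_closure (hSQ _ hq₀), ?_⟩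
    refine not_interior Q (-η.1) (-η.2) hnegne _ ?_
    intro y hy
    have h1 := hneg y hy
    have h2 := hDq
    simp only [pairQ] at h2
    linarith
  -- coordinates
  obtain ⟨u, v, huv⟩ : IsCoprime η.1 η.2 := Int.isCoprime_iff_gcd_eq_one.2 hg
  let φ : ℤ × ℤ → ℤ × ℤ := fun p => (-v * p.1 + u * p.2, η.1 * p.1 + η.2 * p.2)
  have hφ1 : ∀ p, p.1 = -η.2 * (φ p).1 + u * (φ p).2 := by
    intro p
    simp only [φ]
    linear_combination (-p.1) * huv
  have hφ2 : ∀ p, p.2 = η.1 * (φ p).1 + v * (φ p).2 := by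
    intro p
    simp only [φ]
    linear_combination (-p.2) * huv
  have hφinj : Function.Injective φ := by
    intro p q hpq
    apply Prod.ext
    · rw [hφ1 p, hφ1 q, hpq]
    · rw [hφ2 p, hφ2 q, hpq]
  have hBc : (B.image φ).card = B.card := Finset.card_image_of_injective _ hφinj
  rw [hcard, ← hBc]
  have hlQ : (0:ℚ) < l := by exact_mod_cast hl
  have hDQ : (0:ℚ) < D := by
    have : 0 < D := by omega
    exact_mod_cast this
  have hene : ((-η.2, η.1) : ℤ × ℤ) ≠ 0 := by
    intro h
    have a1 : -η.2 = 0 := congrArg Prod.fst h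
    have a2 : η.1 = 0 := congrArg Prod.snd h
    have a3 : η.2 = 0 := by omega
    rw [a2, a3] at hg
    simp at hg
  have hene' : ((η.2, -η.1) : ℤ × ℤ) ≠ 0 := by
    intro h
    have a1 : η.2 = 0 := congrArg Prod.fst h
    have a2 : -η.1 = 0 := congrArg Prod.snd h
    have a3 : η.1 = 0 := by omega
    rw [a1, a3] at hg
    simp at hg
  apply comb (B.image φ) l D k (by omega) hlk hD1 hk
  · intro p hp
    obtain ⟨p, hpB, rfl⟩ := Finset.mem_image.1 hp
    refine ⟨?_, hleZ p (hBQ p hpB)⟩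
    have h1 := hneg _ (hBQ p hpB)
    have h2 : -η.1 * p.1 + -η.2 * p.2 ≤ D := by
      simp only [toQ] at h1
      exact_mod_cast h1
    simp only [φ]
    linarith
  · intro h hh1 hh2
    by_contra hcon
    obtain ⟨a, ha, b, hb, c, hc, hab, hbc⟩ := three_sorted _ h
      (fun p hp => (Finset.mem_filter.1 hp).2) (not_le.1 hcon)
    obtain ⟨ha, ha2⟩ := Finset.mem_filter.1 ha
    obtain ⟨hb, hb2⟩ := Finset.mem_filter.1 hb
    obtain ⟨hc, hc2⟩ := Finset.mem_filter.1 hc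
    obtain ⟨a, haB, rfl⟩ := Finset.mem_image.1 ha
    obtain ⟨b, hbB, rfl⟩ := Finset.mem_image.1 hb
    obtain ⟨c, hcB, rfl⟩ := Finset.mem_image.1 hc
    obtain ⟨θ, m, G, hG, hbG⟩ := frontier_facet S Q hS h0 b ((hmemB b).1 hbB)
    obtain ⟨-, hm, hGle, hGe, -⟩ := hG
    rw [hGe] at hbG
    have hval : ∀ p, θ.1 * p.1 + θ.2 * p.2 =
        (-θ.1 * η.2 + θ.2 * η.1) * (φ p).1 + (θ.1 * u + θ.2 * v) * (φ p).2 := by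
      intro p
      have e1 := hφ1 p
      have e2 := hφ2 p
      linear_combination θ.1 * e1 + θ.2 * e2
    have hleθ : ∀ p, toQ p ∈ Q → (-θ.1 * η.2 + θ.2 * η.1) * (φ p).1 +
        (θ.1 * u + θ.2 * v) * (φ p).2 ≤ m := by
      intro p hp
      have := hGle _ hp
      rw [pairQ_toQ] at this
      rw [← hval]
      exact_mod_cast this
    have hbv : (-θ.1 * η.2 + θ.2 * η.1) * (φ b).1 + (θ.1 * u + θ.2 * v) * (φ b).2 = m := by
      have := hbG.2
      rw [pairQ_toQ] at this
      rw [← hval]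
      exact_mod_cast this
    have i1 := hleθ a (hBQ a haB)
    have i2 := hleθ c (hBQ c hcB)
    have i3 := hleθ p₀ (hSQ _ hp₀)
    have i4 := hleθ q₀ (hSQ _ hq₀)
    have hφp : (φ p₀).2 = l := htop
    have hφq : (φ q₀).2 = -D := hD
    rw [ha2] at i1
    rw [hc2] at i2
    rw [hb2] at hbv
    rw [hφp] at i3
    rw [hφq] at i4
    exact slice_arith hm hab hbc hh1 hh2 i1 hbv i2 i3 i4
  · intro h
    obtain ⟨a, ha, b, hb, hab⟩ := Finset.one_lt_card.1 h
    obtain ⟨ha, ha2⟩ := Finset.mem_filter.1 ha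
    obtain ⟨hb, hb2⟩ := Finset.mem_filter.1 hb
    obtain ⟨a, haB, rfl⟩ := Finset.mem_image.1 ha
    obtain ⟨b, hbB, rfl⟩ := Finset.mem_image.1 hb
    have hne : toQ a ≠ toQ b := by
      intro hc
      apply hab
      congr 1
      have c1 : (a.1:ℚ) = b.1 := congrArg Prod.fst hc
      have c2 : (a.2:ℚ) = b.2 := congrArg Prod.snd hc
      exact Prod.ext (by exact_mod_cast c1) (by exact_mod_cast c2)
    have hpn : ∀ y, pairQ (-η.1, -η.2) y = -(η.1:ℚ) * y.1 + -(η.2:ℚ) * y.2 := by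
      intro y; simp [pairQ]
    have hpv : ∀ p : ℤ × ℤ, (φ p).2 = -D → pairQ (-η.1, -η.2) (toQ p) = D := by
      intro p hp
      have : -η.1 * p.1 + -η.2 * p.2 = D := by
        simp only [φ] at hp
        linarith
      rw [pairQ_toQ]
      exact_mod_cast this
    refine hmx {x ∈ Q | pairQ (-η.1, -η.2) x = (D:ℚ)} (-η.1, -η.2) D ⟨?_, by omega, ?_, rfl, ?_⟩
    · simpa using hg
    · intro y hy
      rw [hpn]
      exact hneg y hy
    · exact ⟨_, ⟨hBQ a haB, hpv a ha2⟩, _, ⟨hBQ b hbB, hpv b hb2⟩, hne⟩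
  · rw [Finset.sum_image (fun _ _ _ _ h => hφinj h)]
    exact hsum
  · intro p hp q hq hpl hqD
    obtain ⟨p, hpB, rfl⟩ := Finset.mem_image.1 hp
    obtain ⟨q, hqB, rfl⟩ := Finset.mem_image.1 hq
    have hd : (0:ℚ) < l + D := by linarith
    have hmid := hconv (hBQ p hpB) (hBQ q hqB) (a := (D:ℚ) / (l + D)) (b := (l:ℚ) / (l + D))
      (div_nonneg hDQ.le hd.le) (div_nonneg hlQ.le hd.le) (by field_simp; ring)
    have ep1 : (p.1:ℚ) = -η.2 * (φ p).1 + u * l := by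
      have := hφ1 p; rw [hpl] at this; exact_mod_cast this
    have ep2 : (p.2:ℚ) = η.1 * (φ p).1 + v * l := by
      have := hφ2 p; rw [hpl] at this; exact_mod_cast this
    have eq1 : (q.1:ℚ) = -η.2 * (φ q).1 + u * (-D) := by
      have := hφ1 q; rw [hqD] at this; exact_mod_cast this
    have eq2 : (q.2:ℚ) = η.1 * (φ q).1 + v * (-D) := by
      have := hφ2 q; rw [hqD] at this; exact_mod_cast this
    have hd' := hd.ne'
    have b1 := dir_bound S Q k hS h0 hmx _ hene
      (((D:ℚ) * (φ p).1 + l * (φ q).1) / (l + D)) (by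
        convert hmid using 1
        ext
        · simp only [toQ, Prod.fst_add, Prod.smul_fst, smul_eq_mul]
          rw [ep1, eq1]
          push_cast
          field_simp
          ring
        · simp only [toQ, Prod.snd_add, Prod.smul_snd, smul_eq_mul]
          rw [ep2, eq2]
          field_simp
          ring)
    have b2 := dir_bound S Q k hS h0 hmx _ hene'
      (-((D:ℚ) * (φ p).1 + l * (φ q).1) / (l + D)) (by
        convert hmid using 1
        ext
        · simp only [toQ, Prod.fst_add, Prod.smul_fst, smul_eq_mul]
          rw [ep1, eq1]
          field_simp
          ring
        · simp only [toQ, Prod.snd_add, Prod.smul_snd, smul_eq_mul]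
          rw [ep2, eq2]
          push_cast
          field_simp
          ring)
    rw [div_le_iff₀ hd] at b1 b2
    constructor
    · exact_mod_cast b1
    · have : -(D * (φ p).1 + l * (φ q).1) ≤ k * (l + D) := by exact_mod_cast b2
      linarith
  · exact ⟨φ p₀, Finset.mem_image_of_mem _ hp₀B, htop⟩
  · exact ⟨φ q₀, Finset.mem_image_of_mem _ hq₀B, hD⟩
end

section
/- Let Q be an IP-polygon with maximal local index m_Q = k ≥ 2. Then Vol(Q) ≤ 4k³ + 8k². If moreover Q is an LDP-polygon, then Vol(Q) ≤ 4k³ + 8k² − 2k; and if Q is an LDP-polygon and k ≥ 3 is prime, then Vol(Q) ≤ 4k³ + 4k² − 2k. -/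
open Pointwise

lemma vb_facet_exists (S : Finset (ℤ × ℤ)) (R : ℝ)
    (hB : ∀ f : ℝ × ℝ, (∀ v ∈ S, f.1 * (v.1 : ℝ) + f.2 * (v.2 : ℝ) ≤ 1) → |f.1| ≤ R ∧ |f.2| ≤ R)
    (g : ℝ × ℝ) :
    ∃ (η : ℤ × ℤ) (l : ℤ) (v w : ℤ × ℤ), Int.gcd η.1 η.2 = 1 ∧ 0 < l ∧
      (∀ s ∈ S, η.1 * s.1 + η.2 * s.2 ≤ l) ∧ v ∈ S ∧ w ∈ S ∧ v ≠ w ∧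
      η.1 * v.1 + η.2 * v.2 = l ∧ η.1 * w.1 + η.2 * w.2 = l ∧
      0 ≤ (η.1 : ℝ) * g.1 + (η.2 : ℝ) * g.2 ∧
      (g ≠ 0 → 0 < (η.1 : ℝ) * g.1 + (η.2 : ℝ) * g.2) := by
  classical
  set P : Set (ℝ × ℝ) := {f | ∀ v ∈ S, f.1 * (v.1 : ℝ) + f.2 * (v.2 : ℝ) ≤ 1} with hP
  have hPclosed : IsClosed P := by
    have : P = ⋂ v ∈ S, {f : ℝ × ℝ | f.1 * (v.1 : ℝ) + f.2 * (v.2 : ℝ) ≤ 1} := by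
      ext f; simp [hP]
    rw [this]
    refine isClosed_biInter fun v _ => ?_
    exact isClosed_le (by fun_prop) (by fun_prop)
  have hPcomp : IsCompact P := by
    refine IsCompact.of_isClosed_subset
      ((isCompact_Icc (a := -R) (b := R)).prod (isCompact_Icc (a := -R) (b := R))) hPclosed ?_
    intro f hf
    obtain ⟨h1, h2⟩ := hB f hf
    exact ⟨abs_le.mp h1, abs_le.mp h2⟩
  have h0P : (0 : ℝ × ℝ) ∈ P := by intro v _; simp
  obtain ⟨f0, hf0P, hf0max⟩ := hPcomp.exists_isMaxOn ⟨0, h0P⟩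
    (f := fun f : ℝ × ℝ => f.1 * g.1 + f.2 * g.2) (by fun_prop)
  have hmax : ∀ f ∈ P, f.1 * g.1 + f.2 * g.2 ≤ f0.1 * g.1 + f0.2 * g.2 := fun f hf => hf0max hf
  set M : Set (ℝ × ℝ) := P ∩ {f | f.1 * g.1 + f.2 * g.2 = f0.1 * g.1 + f0.2 * g.2} with hM
  have hMcomp : IsCompact M := hPcomp.inter_right (isClosed_eq (by fun_prop) (by fun_prop))
  obtain ⟨f, hf⟩ := hMcomp.extremePoints_nonempty ⟨f0, hf0P, rfl⟩
  have hfM : f ∈ M := hf.1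
  have hfP : f ∈ P := hfM.1
  have hfg : f.1 * g.1 + f.2 * g.2 = f0.1 * g.1 + f0.2 * g.2 := hfM.2
  -- no nonzero direction is orthogonal to all tight constraints
  have key : ∀ d : ℝ × ℝ, (∀ v ∈ S, f.1 * (v.1 : ℝ) + f.2 * (v.2 : ℝ) = 1 →
      d.1 * (v.1 : ℝ) + d.2 * (v.2 : ℝ) = 0) → d = 0 := by
    intro d hd
    have hev : ∀ᶠ e : ℝ in nhds 0, ∀ v ∈ S,
        (f.1 + e * d.1) * (v.1 : ℝ) + (f.2 + e * d.2) * (v.2 : ℝ) ≤ 1 := by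
      rw [Filter.eventually_all_finset]
      intro v hv
      rcases (hfP v hv).lt_or_eq with hlt | heq
      · have hc : Continuous fun e : ℝ =>
          (f.1 + e * d.1) * (v.1 : ℝ) + (f.2 + e * d.2) * (v.2 : ℝ) := by fun_prop
        have := (hc.tendsto 0).eventually_lt_const (u := (1:ℝ)) (by simpa using hlt)
        exact this.mono fun _ h => h.le
      · refine Filter.Eventually.of_forall fun e => ?_
        have := hd v hv heq
        have h2 : (f.1 + e * d.1) * (v.1 : ℝ) + (f.2 + e * d.2) * (v.2 : ℝ) = 1 := by
          linear_combination heq + e * this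
        exact h2.le
    obtain ⟨δ, hδ, hball⟩ := Metric.eventually_nhds_iff.mp hev
    have hp : (f.1 + (δ/2) * d.1, f.2 + (δ/2) * d.2) ∈ P := by
      apply hball
      rw [Real.dist_eq, sub_zero, abs_of_pos (by linarith)]; linarith
    have hn : (f.1 + (-(δ/2)) * d.1, f.2 + (-(δ/2)) * d.2) ∈ P := by
      apply hball
      rw [Real.dist_eq, sub_zero, abs_neg, abs_of_pos (by linarith)]; linarith
    have e1 := hmax _ hp
    have e2 := hmax _ hn
    simp only at e1 e2
    have hpM : (f.1 + (δ/2) * d.1, f.2 + (δ/2) * d.2) ∈ M := by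
      refine ⟨hp, ?_⟩
      simp only [Set.mem_ofPred_eq]; nlinarith
    have hnM : (f.1 + (-(δ/2)) * d.1, f.2 + (-(δ/2)) * d.2) ∈ M := by
      refine ⟨hn, ?_⟩
      simp only [Set.mem_ofPred_eq]; nlinarith
    have hseg : f ∈ openSegment ℝ (f.1 + (δ/2) * d.1, f.2 + (δ/2) * d.2)
        (f.1 + (-(δ/2)) * d.1, f.2 + (-(δ/2)) * d.2) := by
      refine ⟨1/2, 1/2, by norm_num, by norm_num, by norm_num, ?_⟩
      ext <;> simp <;> ring
    have := hf.2 hpM hnM hseg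
    have h1 := congrArg Prod.fst this
    have h2 := congrArg Prod.snd this
    simp only at h1 h2
    have hδ2 : δ / 2 ≠ 0 := by positivity
    ext
    · have : (δ/2) * d.1 = 0 := by linarith
      simpa [hδ2] using (mul_eq_zero.mp this)
    · have : (δ/2) * d.2 = 0 := by linarith
      simpa [hδ2] using (mul_eq_zero.mp this)
  -- two independent tight vectors
  have htwo : ∃ v ∈ S, ∃ w ∈ S, f.1 * (v.1 : ℝ) + f.2 * (v.2 : ℝ) = 1 ∧
      f.1 * (w.1 : ℝ) + f.2 * (w.2 : ℝ) = 1 ∧ 0 < v.1 * w.2 - v.2 * w.1 := by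
    have hex : ∃ v ∈ S, f.1 * (v.1 : ℝ) + f.2 * (v.2 : ℝ) = 1 := by
      by_contra hcon
      push Not at hcon
      have := key (1, 0) (fun v hv h => absurd h (hcon v hv))
      simp at this
    obtain ⟨v, hv, hvt⟩ := hex
    have hex2 : ∃ w ∈ S, f.1 * (w.1 : ℝ) + f.2 * (w.2 : ℝ) = 1 ∧ v.1 * w.2 - v.2 * w.1 ≠ 0 := by
      by_contra hcon
      push Not at hcon
      have := key (-(v.2 : ℝ), (v.1 : ℝ)) (fun w hw h => by
        have h3 := hcon w hw h
        have h4 : (v.1 : ℝ) * w.2 - v.2 * w.1 = 0 := by exact_mod_cast h3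
        simp only; linarith)
      have h1 := congrArg Prod.fst this
      have h2 := congrArg Prod.snd this
      simp only [Prod.fst_zero, Prod.snd_zero, neg_eq_zero] at h1 h2
      rw [h1, h2] at hvt
      simp at hvt
    obtain ⟨w, hw, hwt, hD⟩ := hex2
    rcases lt_or_gt_of_ne hD with h | h
    · exact ⟨w, hw, v, hv, hwt, hvt, by linarith⟩
    · exact ⟨v, hv, w, hw, hvt, hwt, h⟩
  obtain ⟨v, hv, w, hw, hvt, hwt, hD⟩ := htwo
  obtain ⟨D, hDdef⟩ : ∃ D : ℤ, D = v.1 * w.2 - v.2 * w.1 := ⟨_, rfl⟩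
  rw [← hDdef] at hD
  have hvw : v ≠ w := by
    rintro rfl
    rw [hDdef] at hD
    nlinarith
  have hn0 : 0 < Int.gcd (w.2 - v.2) (v.1 - w.1) := by
    rw [Int.gcd_pos_iff]
    by_contra hcon
    push Not at hcon
    apply hvw
    ext <;> linarith [hcon.1, hcon.2]
  obtain ⟨a, ha⟩ := Int.gcd_dvd_left (w.2 - v.2) (v.1 - w.1)
  obtain ⟨b, hb⟩ := Int.gcd_dvd_right (w.2 - v.2) (v.1 - w.1)
  have hab : Int.gcd a b = 1 := by
    have := Int.gcd_div_gcd_div_gcd hn0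
    have hne : ((Int.gcd (w.2 - v.2) (v.1 - w.1) : ℕ) : ℤ) ≠ 0 := by exact_mod_cast hn0.ne'
    rwa [Int.ediv_eq_of_eq_mul_right hne ha, Int.ediv_eq_of_eq_mul_right hne hb] at this
  obtain ⟨d, hd⟩ : ∃ d : ℤ, d = ((Int.gcd (w.2 - v.2) (v.1 - w.1) : ℕ) : ℤ) := ⟨_, rfl⟩
  have hdpos : 0 < d := by rw [hd]; exact_mod_cast hn0
  rw [← hd] at ha hb
  have hdl : d * (a * v.1 + b * v.2) = D := by
    rw [hDdef]; linear_combination (-v.1) * ha - v.2 * hb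
  have hdl2 : d * (a * w.1 + b * w.2) = D := by
    rw [hDdef]; linear_combination (-w.1) * ha - w.2 * hb
  have hl0 : 0 < a * v.1 + b * v.2 := by
    by_contra hcon
    push Not at hcon
    nlinarith
  have hlw : a * w.1 + b * w.2 = a * v.1 + b * v.2 := by
    have := hdl2.trans hdl.symm
    exact mul_left_cancel₀ hdpos.ne' this
  obtain ⟨l, hl⟩ : ∃ l : ℤ, l = a * v.1 + b * v.2 := ⟨_, rfl⟩
  rw [← hl] at hl0 hlw hdl
  have hdr : (0:ℝ) < d := by exact_mod_cast hdpos
  have hlr : (0:ℝ) < l := by exact_mod_cast hl0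
  have har : (w.2 : ℝ) - v.2 = d * a := by exact_mod_cast ha
  have hbr : (v.1 : ℝ) - w.1 = d * b := by exact_mod_cast hb
  have hDr : (d : ℝ) * l = v.1 * w.2 - v.2 * w.1 := by
    have := hdl.trans hDdef
    exact_mod_cast this
  have hfa : (a : ℝ) = l * f.1 := by
    apply mul_left_cancel₀ hdr.ne'
    rw [← har]
    linear_combination (-f.1) * hDr - (w.2:ℝ) * hvt + (v.2:ℝ) * hwt
  have hfb : (b : ℝ) = l * f.2 := by
    apply mul_left_cancel₀ hdr.ne'
    rw [← hbr]
    linear_combination (-f.2) * hDr - (v.1:ℝ) * hwt + (w.1:ℝ) * hvt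
  have hpair : ∀ x y : ℝ, (a : ℝ) * x + b * y = l * (f.1 * x + f.2 * y) := by
    intro x y; rw [hfa, hfb]; ring
  refine ⟨(a, b), l, v, w, hab, hl0, ?_, hv, hw, hvw, hl.symm, hlw, ?_, ?_⟩
  · intro s hs
    have h1 := hpair s.1 s.2
    have h2 := hfP s hs
    have : (a : ℝ) * s.1 + b * s.2 ≤ l := by rw [h1]; nlinarith
    exact_mod_cast this
  · simp only
    rw [hpair, hfg]
    have := hmax 0 h0P
    simp only [Prod.fst_zero, Prod.snd_zero, zero_mul, add_zero] at this
    positivity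
  · intro hg
    simp only
    rw [hpair, hfg]
    apply mul_pos hlr
    have hev : ∀ᶠ e : ℝ in nhds 0, ∀ v ∈ S,
        (e * g.1) * (v.1 : ℝ) + (e * g.2) * (v.2 : ℝ) ≤ 1 := by
      rw [Filter.eventually_all_finset]
      intro v hv
      have hc : Continuous fun e : ℝ =>
          (e * g.1) * (v.1 : ℝ) + (e * g.2) * (v.2 : ℝ) := by fun_prop
      have := (hc.tendsto 0).eventually_lt_const (u := (1:ℝ)) (by simp)
      exact this.mono fun _ h => h.le
    obtain ⟨δ, hδ, hball⟩ := Metric.eventually_nhds_iff.mp hev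
    have hp : ((δ/2) * g.1, (δ/2) * g.2) ∈ P := by
      apply hball
      rw [Real.dist_eq, sub_zero, abs_of_pos (by linarith)]; linarith
    have e1 := hmax _ hp
    simp only at e1
    have hsq : 0 < g.1 ^ 2 + g.2 ^ 2 := by
      by_contra hcon
      apply hg
      ext
      · simp only [Prod.fst_zero]; nlinarith [sq_nonneg g.1, sq_nonneg g.2]
      · simp only [Prod.snd_zero]; nlinarith [sq_nonneg g.1, sq_nonneg g.2]
    nlinarith

/-- The closed trapezoid. -/
def vbTrap (a b l1 m1 l2 m2 : ℝ) : Set (ℝ × ℝ) :=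
  {z | a ≤ z.1 ∧ z.1 ≤ b ∧ l2 + m2 * z.1 ≤ z.2 ∧ z.2 ≤ l1 + m1 * z.1}

lemma vb_trap_closed (a b l1 m1 l2 m2 : ℝ) : IsClosed (vbTrap a b l1 m1 l2 m2) := by
  unfold vbTrap
  refine IsClosed.and (isClosed_le (by fun_prop) (by fun_prop)) ?_
  refine IsClosed.and (isClosed_le (by fun_prop) (by fun_prop)) ?_
  exact IsClosed.and (isClosed_le (by fun_prop) (by fun_prop))
    (isClosed_le (by fun_prop) (by fun_prop))

lemma vb_trap_compact (a b l1 m1 l2 m2 : ℝ) : IsCompact (vbTrap a b l1 m1 l2 m2) := by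
  set N := |a| + |b|
  refine IsCompact.of_isClosed_subset
    ((isCompact_Icc (a := a) (b := b)).prod
      (isCompact_Icc (a := -(|l2| + |m2| * N)) (b := |l1| + |m1| * N))) (vb_trap_closed ..) ?_
  rintro z ⟨h1, h2, h3, h4⟩
  have hz : |z.1| ≤ N := by
    rw [abs_le]
    constructor
    · linarith [neg_abs_le a, abs_nonneg b]
    · linarith [le_abs_self b, abs_nonneg a]
  have e1 : |m1 * z.1| ≤ |m1| * N := by
    rw [abs_mul]; exact mul_le_mul_of_nonneg_left hz (abs_nonneg _)
  have e2 : |m2 * z.1| ≤ |m2| * N := by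
    rw [abs_mul]; exact mul_le_mul_of_nonneg_left hz (abs_nonneg _)
  refine ⟨⟨h1, h2⟩, ?_, ?_⟩
  · linarith [neg_abs_le l2, neg_abs_le (m2 * z.1)]
  · linarith [le_abs_self l1, le_abs_self (m1 * z.1)]

lemma vb_trap_integral (a b l1 m1 l2 m2 α β : ℝ) (hab : a ≤ b)
    (hw : ∀ h, a ≤ h → h ≤ b → l2 + m2 * h ≤ l1 + m1 * h) :
    ∫ z in vbTrap a b l1 m1 l2 m2, (α + β * z.1) =
      α * (l1 - l2) * (b - a) + (α * (m1 - m2) + β * (l1 - l2)) * (b ^ 2 - a ^ 2) / 2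
        + β * (m1 - m2) * (b ^ 3 - a ^ 3) / 3 := by
  have hint : MeasureTheory.IntegrableOn (fun z : ℝ × ℝ => α + β * z.1)
      (vbTrap a b l1 m1 l2 m2) :=
    ContinuousOn.integrableOn_compact (vb_trap_compact ..) (by fun_prop)
  have hmeas := (vb_trap_closed a b l1 m1 l2 m2).measurableSet
  rw [← MeasureTheory.integral_indicator hmeas, MeasureTheory.Measure.volume_eq_prod,
    MeasureTheory.integral_prod _ (by
      rw [← MeasureTheory.Measure.volume_eq_prod]
      exact (MeasureTheory.integrable_indicator_iff hmeas).mpr hint)]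
  have hinner : ∀ h : ℝ, (∫ x : ℝ, (vbTrap a b l1 m1 l2 m2).indicator
      (fun z : ℝ × ℝ => α + β * z.1) (h, x)) =
      (Set.Icc a b).indicator (fun h => (α + β * h) * ((l1 - l2) + (m1 - m2) * h)) h := by
    intro h
    by_cases hh : h ∈ Set.Icc a b
    · rw [Set.indicator_of_mem hh]
      have : (fun x : ℝ => (vbTrap a b l1 m1 l2 m2).indicator
          (fun z : ℝ × ℝ => α + β * z.1) (h, x)) =
          (Set.Icc (l2 + m2 * h) (l1 + m1 * h)).indicator (fun _ => α + β * h) := by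
        funext x
        by_cases hx : x ∈ Set.Icc (l2 + m2 * h) (l1 + m1 * h)
        · rw [Set.indicator_of_mem hx, Set.indicator_of_mem]
          exact ⟨hh.1, hh.2, hx.1, hx.2⟩
        · rw [Set.indicator_of_notMem hx, Set.indicator_of_notMem]
          rintro ⟨_, _, h3, h4⟩
          exact hx ⟨h3, h4⟩
      rw [this, MeasureTheory.integral_indicator measurableSet_Icc,
        MeasureTheory.setIntegral_const, Real.volume_real_Icc_of_le (hw h hh.1 hh.2), smul_eq_mul]
      ring
    · rw [Set.indicator_of_notMem hh]
      have : (fun x : ℝ => (vbTrap a b l1 m1 l2 m2).indicator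
          (fun z : ℝ × ℝ => α + β * z.1) (h, x)) = fun _ => 0 := by
        funext x
        rw [Set.indicator_of_notMem]
        rintro ⟨h1, h2, _⟩
        exact hh ⟨h1, h2⟩
      rw [this]; simp
  simp_rw [hinner]
  rw [MeasureTheory.integral_indicator measurableSet_Icc, MeasureTheory.integral_Icc_eq_integral_Ioc,
    ← intervalIntegral.integral_of_le hab]
  rw [intervalIntegral.integral_eq_sub_of_hasDerivAt
    (f := fun h => α * (l1 - l2) * h + (α * (m1 - m2) + β * (l1 - l2)) * h ^ 2 / 2
        + β * (m1 - m2) * h ^ 3 / 3)]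
  · ring
  · intro x _
    have h1 := (hasDerivAt_id x).const_mul (α * (l1 - l2))
    have h2 := ((hasDerivAt_pow 2 x).const_mul (α * (m1 - m2) + β * (l1 - l2))).div_const 2
    have h3 := ((hasDerivAt_pow 3 x).const_mul (β * (m1 - m2))).div_const 3
    refine ((h1.add h2).add h3).congr_deriv ?_
    simp; ring
  · exact Continuous.intervalIntegrable (by fun_prop) _ _

/-- A determinant one linear map preserves area. -/
lemma vb_measurePreserving (a b c d : ℝ) (h : a * d - b * c = 1) :
    MeasureTheory.MeasurePreserving (fun z : ℝ × ℝ => (a * z.1 + b * z.2, c * z.1 + d * z.2))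
      MeasureTheory.volume MeasureTheory.volume ∧
    MeasurableEmbedding (fun z : ℝ × ℝ => (a * z.1 + b * z.2, c * z.1 + d * z.2)) := by
  set f : ℝ × ℝ →ₗ[ℝ] ℝ × ℝ :=
    Matrix.toLin (Module.Basis.finTwoProd ℝ) (Module.Basis.finTwoProd ℝ) !![a, b; c, d] with hf
  have hfun : (fun z : ℝ × ℝ => (a * z.1 + b * z.2, c * z.1 + d * z.2)) = f := by
    funext z
    rw [hf, Matrix.toLin_finTwoProd_apply]
  have hdet : LinearMap.det f = 1 := by
    rw [hf, LinearMap.det_toLin, Matrix.det_fin_two_of, h]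
  constructor
  · refine ⟨by fun_prop, ?_⟩
    rw [hfun, MeasureTheory.Measure.map_linearMap_addHaar_eq_smul_addHaar _ (by rw [hdet]; simp), hdet]
    simp
  · refine Continuous.measurableEmbedding (by fun_prop) ?_
    intro x y hxy
    simp only [Prod.mk.injEq] at hxy
    obtain ⟨h1, h2⟩ := hxy
    ext
    · linear_combination d * h1 - b * h2 - (x.1 - y.1) * h
    · linear_combination a * h2 - c * h1 - (x.2 - y.2) * h

lemma vb_analysis (C : Set (ℝ × ℝ)) (hC : IsCompact C) (a b c d : ℝ) (hdet : a * d - b * c = 1)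
    (k l m L1 M1 L2 M2 : ℝ)
    (hsub : ∀ z ∈ C, (a * z.1 + b * z.2, c * z.1 + d * z.2) ∈ vbTrap (-m) l L1 M1 L2 M2)
    (hcen : 0 ≤ ∫ z in C, (a * z.1 + b * z.2))
    (hm : 1 ≤ m) (hl : 1 ≤ l) (hlk : l ≤ k) (hL1 : L1 ≤ k) (hL2 : -L2 ≤ k)
    (hc : 0 ≤ L1 - L2)
    (hwm : 0 ≤ (L1 - L2) - (M1 - M2) * m) (hwl : 0 ≤ (L1 - L2) + (M1 - M2) * l) :
    2 * (MeasureTheory.volume C).toReal ≤ 2 * k * (k + 1) ^ 2 ∨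
    2 * (MeasureTheory.volume C).toReal ≤ 32 / 3 * k ^ 2 := by
  obtain ⟨hmp, hemb⟩ := vb_measurePreserving a b c d hdet
  set A : ℝ × ℝ → ℝ × ℝ := fun z => (a * z.1 + b * z.2, c * z.1 + d * z.2) with hA
  have hw : ∀ h, -m ≤ h → h ≤ l → L2 + M2 * h ≤ L1 + M1 * h := by
    intro h h1 h2
    have : 0 ≤ (L1 - L2) + (M1 - M2) * h := by
      rcases le_total 0 (M1 - M2) with hs | hs
      · nlinarith
      · nlinarith
    linarith
  have hck : L1 - L2 ≤ 2 * k := by linarith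
  obtain ⟨w, hwd⟩ : ∃ w, w = L1 - L2 := ⟨_, rfl⟩
  obtain ⟨s, hsd⟩ : ∃ s, s = M1 - M2 := ⟨_, rfl⟩
  have hCfin : MeasureTheory.volume C ≠ ⊤ := hC.measure_lt_top.ne
  rcases le_or_gt m l with hml | hml
  · -- direct trapezoid bound
    set T := vbTrap (-m) l L1 M1 L2 M2 with hT
    have hTfin : MeasureTheory.volume T ≠ ⊤ := (vb_trap_compact ..).measure_lt_top.ne
    have hle : MeasureTheory.volume C ≤ MeasureTheory.volume T := by
      rw [← hmp.measure_preimage (vb_trap_closed ..).measurableSet.nullMeasurableSet]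
      exact MeasureTheory.measure_mono hsub
    have hle' := ENNReal.toReal_mono hTfin hle
    have hI := vb_trap_integral (-m) l L1 M1 L2 M2 1 0 (by linarith) hw
    have hI2 : (MeasureTheory.volume T).toReal = ∫ z in T, ((1:ℝ) + 0 * z.1) := by
      simp [MeasureTheory.Measure.real]
    rw [← hT, ← hI2, ← hwd, ← hsd] at hI
    rw [← hwd] at hck hc
    rw [← hwd, ← hsd] at hwm hwl
    have hV : (MeasureTheory.volume C).toReal ≤ w * (l + m) + s * (l ^ 2 - m ^ 2) / 2 := by
      rw [hI] at hle'
      linarith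
    rcases le_total s 0 with hs | hs
    · right
      have h1 : 0 ≤ (-s) * (l ^ 2 - m ^ 2) := by
        apply mul_nonneg (by linarith); nlinarith
      have h2 : w * (l + m) ≤ (2 * k) * (2 * k) := by
        apply mul_le_mul hck (by linarith) (by linarith) (by linarith)
      nlinarith [sq_nonneg k]
    · left
      have hmpos : 0 < m := by linarith
      have h1 : (MeasureTheory.volume C).toReal * m ≤ w * (l + m) ^ 2 / 2 := by
        have e1 : (w * (l + m) + s * (l ^ 2 - m ^ 2) / 2) * m ≤ w * (l + m) ^ 2 / 2 := by
          have : 0 ≤ (w - s * m) * (l ^ 2 - m ^ 2) := by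
            apply mul_nonneg hwm; nlinarith
          nlinarith
        nlinarith
      have h2 : (l + m) ^ 2 ≤ m * (l + 1) ^ 2 := by
        have : 0 ≤ (m - 1) * (l ^ 2 - m) := by
          apply mul_nonneg (by linarith); nlinarith
        nlinarith
      have h3 : (l + 1) ^ 2 ≤ (k + 1) ^ 2 := by
        apply pow_le_pow_left₀ (by linarith) (by linarith)
      have h4 : w * (l + m) ^ 2 ≤ (2 * k) * (m * (k + 1) ^ 2) := by
        apply mul_le_mul hck _ (by positivity) (by linarith)
        nlinarith
      have h5 : (2 * (MeasureTheory.volume C).toReal) * m ≤ (2 * k * (k + 1) ^ 2) * m := by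
        linarith
      exact le_of_mul_le_mul_right h5 hmpos
  · right
    have hlpos : 0 < l := by linarith
    set T := vbTrap (-l) l L1 M1 L2 M2 with hT
    have hTm : MeasurableSet T := (vb_trap_closed ..).measurableSet
    have hI := vb_trap_integral (-l) l L1 M1 L2 M2 1 (1 / l) (by linarith)
      (fun h h1 h2 => hw h (by linarith) h2)
    rw [← hT] at hI
    set ψ : ℝ × ℝ → ℝ := fun z => 1 + 1 / l * z.1 with hψ
    have hAc : Continuous A := by fun_prop
    have hBm : MeasurableSet (A ⁻¹' T) := hTm.preimage hAc.measurable
    have hpre : ∫ z in A ⁻¹' T, ψ (A z) = ∫ z in T, ψ z := hmp.setIntegral_preimage_emb hemb ψ T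
    have hTint : MeasureTheory.IntegrableOn ψ T :=
      ContinuousOn.integrableOn_compact (vb_trap_compact ..) (by fun_prop)
    have hBint : MeasureTheory.IntegrableOn (fun z => ψ (A z)) (A ⁻¹' T) :=
      (hmp.integrableOn_comp_preimage hemb).mpr hTint
    have hCint : MeasureTheory.IntegrableOn (fun z => ψ (A z)) C :=
      ContinuousOn.integrableOn_compact hC (by fun_prop)
    have hCm : MeasurableSet C := hC.measurableSet
    have hvol : (MeasureTheory.volume C).toReal ≤ ∫ z in C, ψ (A z) := by
      have e1 : ∫ z in C, ψ (A z) = (∫ z in C, (1:ℝ)) + ∫ z in C, 1 / l * (a * z.1 + b * z.2) := by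
        rw [← MeasureTheory.integral_add]
        · exact ContinuousOn.integrableOn_compact hC (by fun_prop)
        · exact ContinuousOn.integrableOn_compact hC (by fun_prop)
      rw [e1, MeasureTheory.integral_const_mul]
      have : ∫ z in C, (1:ℝ) = (MeasureTheory.volume C).toReal := by
        simp [MeasureTheory.Measure.real]
      rw [this]
      have : 0 ≤ 1 / l * ∫ z in C, (a * z.1 + b * z.2) := by positivity
      linarith
    have hsplit := MeasureTheory.integral_inter_add_sdiff hBm hCint
    have hneg : ∫ z in C \ (A ⁻¹' T), ψ (A z) ≤ 0 := by
      apply MeasureTheory.setIntegral_nonpos (hCm.diff hBm)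
      rintro z ⟨hz, hzn⟩
      obtain ⟨h1, h2, h3, h4⟩ := hsub z hz
      have hlt : (A z).1 < -l := by
        by_contra hcon
        push Not at hcon
        exact hzn ⟨hcon, h2, h3, h4⟩
      have : 1 / l * (A z).1 ≤ 1 / l * (-l) := by
        apply mul_le_mul_of_nonneg_left hlt.le (by positivity)
      have e : 1 / l * (-l) = -1 := by field_simp
      simp only [hψ]
      linarith
    have hmono : ∫ z in C ∩ (A ⁻¹' T), ψ (A z) ≤ ∫ z in A ⁻¹' T, ψ (A z) := by
      apply MeasureTheory.setIntegral_mono_set hBint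
      · refine (MeasureTheory.ae_restrict_iff' hBm).mpr (Filter.Eventually.of_forall ?_)
        rintro z ⟨h1, -⟩
        have : 1 / l * (-l) ≤ 1 / l * (A z).1 := by
          apply mul_le_mul_of_nonneg_left h1 (by positivity)
        have e : 1 / l * (-l) = -1 := by field_simp
        simp only [hψ, Pi.zero_apply]
        linarith
      · exact Set.inter_subset_right.eventuallyLE
    have hV : (MeasureTheory.volume C).toReal ≤ 2 * w * l + 2 / 3 * s * l ^ 2 := by
      have e : ∫ z in T, ψ z = 2 * w * l + 2 / 3 * s * l ^ 2 := by
        rw [hI, hwd, hsd]; field_simp; ring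
      linarith
    rw [← hwd] at hck hc
    rw [← hwd, ← hsd] at hwm hwl
    clear hsplit hneg hmono hvol hpre hI hTint hBint hCint hsub hcen hw
    have hsl : s * l ≤ w := by
      rcases le_total s 0 with hs | hs
      · have : s * l ≤ 0 := mul_nonpos_of_nonpos_of_nonneg hs hlpos.le
        linarith
      · have : s * l ≤ s * m := mul_le_mul_of_nonneg_left hml.le hs
        linarith
    have h1 : (s * l) * l ≤ w * l := mul_le_mul_of_nonneg_right hsl hlpos.le
    have h2 : w * l ≤ (2 * k) * k := by
      apply mul_le_mul hck hlk (by linarith) (by linarith)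
    have h3 : s * l ^ 2 = (s * l) * l := by ring
    have h4 : 2 / 3 * s * l ^ 2 = 2 / 3 * ((s * l) * l) := by ring
    have h5 : 32 / 3 * k ^ 2 = 16 / 3 * ((2 * k) * k) := by ring
    linarith

/-- The embedding of the lattice in the real plane. -/
def vbR (p : ℤ × ℤ) : ℝ × ℝ := ((p.1 : ℝ), (p.2 : ℝ))

lemma vb_halfspace (S : Finset (ℤ × ℤ)) (a b t : ℝ)
    (h : ∀ v ∈ S, a * (v.1 : ℝ) + b * (v.2 : ℝ) ≤ t) :
    ∀ z ∈ convexHull ℝ (vbR '' (S : Set (ℤ × ℤ))), a * z.1 + b * z.2 ≤ t := by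
  have hconv : Convex ℝ {z : ℝ × ℝ | a * z.1 + b * z.2 ≤ t} := by
    intro x hx y hy p q hp hq hpq
    simp only [Set.mem_ofPred_eq, Prod.fst_add, Prod.snd_add, Prod.smul_fst, Prod.smul_snd,
      smul_eq_mul] at *
    have : p * t + q * t = t := by rw [← add_mul, hpq, one_mul]
    nlinarith [mul_le_mul_of_nonneg_left hx hp, mul_le_mul_of_nonneg_left hy hq]
  refine fun z hz => convexHull_min ?_ hconv hz
  rintro _ ⟨v, hv, rfl⟩
  exact h v hv

lemma vb_core (S : Finset (ℤ × ℤ)) (k : ℤ) (ε : ℝ) (hε : 0 < ε)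
    (h1 : ((ε, 0) : ℝ × ℝ) ∈ convexHull ℝ (vbR '' (S : Set (ℤ × ℤ))))
    (h2 : ((-ε, 0) : ℝ × ℝ) ∈ convexHull ℝ (vbR '' (S : Set (ℤ × ℤ))))
    (h3 : ((0, ε) : ℝ × ℝ) ∈ convexHull ℝ (vbR '' (S : Set (ℤ × ℤ))))
    (h4 : ((0, -ε) : ℝ × ℝ) ∈ convexHull ℝ (vbR '' (S : Set (ℤ × ℤ))))
    (hfac : ∀ (η : ℤ × ℤ) (l : ℤ) (v w : ℤ × ℤ), Int.gcd η.1 η.2 = 1 → 0 < l →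
      (∀ s ∈ S, η.1 * s.1 + η.2 * s.2 ≤ l) → v ∈ S → w ∈ S → v ≠ w →
      η.1 * v.1 + η.2 * v.2 = l → η.1 * w.1 + η.2 * w.2 = l → l ≤ k) :
    2 * (MeasureTheory.volume (convexHull ℝ (vbR '' (S : Set (ℤ × ℤ))))).toReal
        ≤ 2 * (k : ℝ) * (k + 1) ^ 2 ∨
    2 * (MeasureTheory.volume (convexHull ℝ (vbR '' (S : Set (ℤ × ℤ))))).toReal
        ≤ 32 / 3 * (k : ℝ) ^ 2 := by
  have hhs := vb_halfspace S
  have hSC : ∀ v ∈ S, vbR v ∈ convexHull ℝ (vbR '' (S : Set (ℤ × ℤ))) :=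
    fun v hv => subset_convexHull ℝ _ ⟨v, hv, rfl⟩
  have hC : IsCompact (convexHull ℝ (vbR '' (S : Set (ℤ × ℤ)))) :=
    (S.finite_toSet.image vbR).isCompact_convexHull ℝ
  set C := convexHull ℝ (vbR '' (S : Set (ℤ × ℤ))) with hCdef
  have hB : ∀ f : ℝ × ℝ, (∀ v ∈ S, f.1 * (v.1 : ℝ) + f.2 * (v.2 : ℝ) ≤ 1) →
      |f.1| ≤ 1 / ε ∧ |f.2| ≤ 1 / ε := by
    intro f hf
    have e := hhs f.1 f.2 1 hf
    have e1 := e _ h1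
    have e2 := e _ h2
    have e3 := e _ h3
    have e4 := e _ h4
    simp only [mul_zero, add_zero, zero_add] at e1 e2 e3 e4
    constructor
    · rw [le_div_iff₀ hε]
      rcases abs_cases f.1 with ⟨h, _⟩ | ⟨h, _⟩ <;> rw [h] <;> linarith
    · rw [le_div_iff₀ hε]
      rcases abs_cases f.2 with ⟨h, _⟩ | ⟨h, _⟩ <;> rw [h] <;> linarith
  obtain ⟨η, l, v, w, hgcd, hl, hηS, hv, hw, hvw, hηv, hηw, hcen, -⟩ :=
    vb_facet_exists S (1 / ε) hB (∫ z in C, z.1, ∫ z in C, z.2)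
  have hlk := hfac η l v w hgcd hl hηS hv hw hvw hηv hηw
  -- lowest vertex
  obtain ⟨v0, hv0, hmin⟩ := S.exists_min_image (fun s => η.1 * s.1 + η.2 * s.2) ⟨v, hv⟩
  obtain ⟨m, hm⟩ : ∃ m : ℤ, m = -(η.1 * v0.1 + η.2 * v0.2) := ⟨_, rfl⟩
  have hηlow : ∀ z ∈ C, (-(η.1:ℝ)) * z.1 + (-(η.2 : ℝ)) * z.2 ≤ m := by
    apply hhs
    intro s hs
    have := hmin s hs
    have : -(η.1 * s.1 + η.2 * s.2) ≤ m := by rw [hm]; linarith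
    have : -((η.1 : ℝ) * s.1 + η.2 * s.2) ≤ m := by exact_mod_cast this
    linarith
  have hηne : η.1 ≠ 0 ∨ η.2 ≠ 0 := by
    by_contra hcon
    push Not at hcon
    rw [hcon.1, hcon.2] at hgcd
    simp at hgcd
  have hm1 : 1 ≤ m := by
    have e1 := hηlow _ h1
    have e2 := hηlow _ h2
    have e3 := hηlow _ h3
    have e4 := hηlow _ h4
    simp only [mul_zero, add_zero, zero_add] at e1 e2 e3 e4
    by_contra hcon
    have hm0 : (m : ℝ) ≤ 0 := by
      have : m ≤ 0 := by omega
      exact_mod_cast this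
    have a1 : (η.1 : ℝ) = 0 := by nlinarith
    have a2 : (η.2 : ℝ) = 0 := by nlinarith
    rcases hηne with h | h
    · exact h (by exact_mod_cast a1)
    · exact h (by exact_mod_cast a2)
  -- complementary coordinate
  obtain ⟨α, β, hαβ⟩ : ∃ α β : ℤ, η.1 * β - η.2 * α = 1 := by
    have := Int.gcd_eq_gcd_ab η.1 η.2
    rw [hgcd] at this
    refine ⟨-Int.gcdB η.1 η.2, Int.gcdA η.1 η.2, ?_⟩
    push_cast at this
    linarith
  have hune : ((-(η.2 : ℝ), (η.1 : ℝ)) : ℝ × ℝ) ≠ 0 := by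
    intro h
    have a1 := congrArg Prod.fst h
    have a2 := congrArg Prod.snd h
    simp only [Prod.fst_zero, Prod.snd_zero, neg_eq_zero] at a1 a2
    rcases hηne with h | h
    · exact h (by exact_mod_cast a2)
    · exact h (by exact_mod_cast a1)
  have hune2 : (((η.2 : ℝ), -(η.1 : ℝ)) : ℝ × ℝ) ≠ 0 := by
    intro h
    have a1 := congrArg Prod.fst h
    have a2 := congrArg Prod.snd h
    simp only [Prod.fst_zero, Prod.snd_zero, neg_eq_zero] at a1 a2
    rcases hηne with h | h
    · exact h (by exact_mod_cast a2)
    · exact h (by exact_mod_cast a1)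
  obtain ⟨θ, l1, v1, w1, hg1, hl1, hθS, hv1, hw1, hvw1, hθv, hθw, -, hp⟩ :=
    vb_facet_exists S (1 / ε) hB (-(η.2 : ℝ), (η.1 : ℝ))
  have hl1k := hfac θ l1 v1 w1 hg1 hl1 hθS hv1 hw1 hvw1 hθv hθw
  obtain ⟨κ, l2, v2, w2, hg2, hl2, hκS, hv2, hw2, hvw2, hκv, hκw, -, hp2⟩ :=
    vb_facet_exists S (1 / ε) hB ((η.2 : ℝ), -(η.1 : ℝ))
  have hl2k := hfac κ l2 v2 w2 hg2 hl2 hκS hv2 hw2 hvw2 hκv hκw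
  have hp := hp hune
  have hp2 := hp2 hune2
  obtain ⟨p, hpd⟩ : ∃ p : ℤ, p = θ.2 * η.1 - θ.1 * η.2 := ⟨_, rfl⟩
  obtain ⟨q, hqd⟩ : ∃ q : ℤ, q = θ.1 * β - θ.2 * α := ⟨_, rfl⟩
  obtain ⟨p', hpd'⟩ : ∃ p : ℤ, p = κ.1 * η.2 - κ.2 * η.1 := ⟨_, rfl⟩
  obtain ⟨q', hqd'⟩ : ∃ q : ℤ, q = κ.1 * β - κ.2 * α := ⟨_, rfl⟩
  have hpr : (p : ℝ) = θ.2 * η.1 - θ.1 * η.2 := by exact_mod_cast hpd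
  have hqr : (q : ℝ) = θ.1 * β - θ.2 * α := by exact_mod_cast hqd
  have hpr' : (p' : ℝ) = κ.1 * η.2 - κ.2 * η.1 := by exact_mod_cast hpd'
  have hqr' : (q' : ℝ) = κ.1 * β - κ.2 * α := by exact_mod_cast hqd'
  have hdetr : (η.1 : ℝ) * β - η.2 * α = 1 := by exact_mod_cast hαβ
  have hp0 : (1 : ℝ) ≤ p := by
    have : (0 : ℝ) < p := by rw [hpr]; simp only at hp; linarith
    have : 0 < p := by exact_mod_cast this
    exact_mod_cast this
  have hp0' : (1 : ℝ) ≤ p' := by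
    have : (0 : ℝ) < p' := by rw [hpr']; simp only at hp2; linarith
    have : 0 < p' := by exact_mod_cast this
    exact_mod_cast this
  have hpp : (0 : ℝ) < p := by linarith
  have hpp' : (0 : ℝ) < p' := by linarith
  have hlr : (1 : ℝ) ≤ l := by exact_mod_cast hl
  have hl1r : (0 : ℝ) < l1 := by exact_mod_cast hl1
  have hl2r : (0 : ℝ) < l2 := by exact_mod_cast hl2
  have hlkr : (l : ℝ) ≤ k := by exact_mod_cast hlk
  have hl1kr : (l1 : ℝ) ≤ k := by exact_mod_cast hl1k
  have hl2kr : (l2 : ℝ) ≤ k := by exact_mod_cast hl2k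
  have hηC : ∀ z ∈ C, (η.1 : ℝ) * z.1 + (η.2 : ℝ) * z.2 ≤ l :=
    hhs _ _ _ fun s hs => by exact_mod_cast hηS s hs
  have hθC : ∀ z ∈ C, (θ.1 : ℝ) * z.1 + (θ.2 : ℝ) * z.2 ≤ l1 :=
    hhs _ _ _ fun s hs => by exact_mod_cast hθS s hs
  have hκC : ∀ z ∈ C, (κ.1 : ℝ) * z.1 + (κ.2 : ℝ) * z.2 ≤ l2 :=
    hhs _ _ _ fun s hs => by exact_mod_cast hκS s hs
  have hup : ∀ z ∈ C, (α : ℝ) * z.1 + β * z.2 ≤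
      l1 / p + (-(q / p)) * ((η.1 : ℝ) * z.1 + (η.2 : ℝ) * z.2) := by
    intro z hz
    have e := hθC z hz
    have e2 : (θ.1 : ℝ) * z.1 + (θ.2 : ℝ) * z.2 = p * ((α : ℝ) * z.1 + β * z.2)
        + q * ((η.1 : ℝ) * z.1 + (η.2 : ℝ) * z.2) := by
      rw [hpr, hqr]
      linear_combination (-(θ.1 * z.1 + θ.2 * z.2)) * hdetr
    have e3 : (l1:ℝ) / p + (-(q / p)) * ((η.1 : ℝ) * z.1 + (η.2 : ℝ) * z.2) =
      (l1 - q * ((η.1 : ℝ) * z.1 + (η.2 : ℝ) * z.2)) / p := by field_simp; ring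
    rw [e3, le_div_iff₀ hpp]
    linarith
  have hlo : ∀ z ∈ C, -(l2 / p' : ℝ) + (q' / p') * ((η.1 : ℝ) * z.1 + (η.2 : ℝ) * z.2) ≤
      (α : ℝ) * z.1 + β * z.2 := by
    intro z hz
    have e := hκC z hz
    have e2 : (κ.1 : ℝ) * z.1 + (κ.2 : ℝ) * z.2 = -p' * ((α : ℝ) * z.1 + β * z.2)
        + q' * ((η.1 : ℝ) * z.1 + (η.2 : ℝ) * z.2) := by
      rw [hpr', hqr']
      linear_combination (-(κ.1 * z.1 + κ.2 * z.2)) * hdetr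
    have e3 : -(l2 / p' : ℝ) + (q' / p') * ((η.1 : ℝ) * z.1 + (η.2 : ℝ) * z.2) =
      (q' * ((η.1 : ℝ) * z.1 + (η.2 : ℝ) * z.2) - l2) / p' := by field_simp; ring
    rw [e3, div_le_iff₀ hpp']
    linarith
  have hwidth : ∀ z ∈ C, 0 ≤ (l1 / p - -(l2 / p' : ℝ)) +
      (-(q / p) - q' / p') * ((η.1 : ℝ) * z.1 + (η.2 : ℝ) * z.2) := by
    intro z hz
    linarith [hup z hz, hlo z hz]
  refine vb_analysis C hC η.1 η.2 α β hdetr k l m (l1 / p) (-(q / p)) (-(l2 / p')) (q' / p')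
    ?_ ?_ (by exact_mod_cast hm1) hlr hlkr ?_ ?_ ?_ ?_ ?_
  · intro z hz
    exact ⟨by linarith [hηlow z hz], hηC z hz, hlo z hz, hup z hz⟩
  · rw [MeasureTheory.integral_add, MeasureTheory.integral_const_mul,
      MeasureTheory.integral_const_mul]
    · exact hcen
    · exact ContinuousOn.integrableOn_compact hC (by fun_prop)
    · exact ContinuousOn.integrableOn_compact hC (by fun_prop)
  · exact (div_le_self hl1r.le hp0).trans hl1kr
  · rw [neg_neg]
    exact (div_le_self hl2r.le hp0').trans hl2kr
  · have : 0 < (l1 : ℝ) / p := by positivity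
    have : 0 < (l2 : ℝ) / p' := by positivity
    linarith
  · have e := hwidth _ (hSC v0 hv0)
    have e2 : (η.1 : ℝ) * (vbR v0).1 + (η.2 : ℝ) * (vbR v0).2 = -m := by
      have : (m : ℝ) = -(η.1 * v0.1 + η.2 * v0.2) := by exact_mod_cast hm
      rw [this]; simp [vbR]
    rw [e2] at e
    linarith
  · have e := hwidth _ (hSC v hv)
    have e2 : (η.1 : ℝ) * (vbR v).1 + (η.2 : ℝ) * (vbR v).2 = l := by
      rw [← hηv]; simp [vbR]
    rw [e2] at e
    linarith

/-- Volume bounds in terms of the maximal local index `m_Q = k ≥ 2`: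
`Vol(Q) ≤ 4k³ + 8k²` for IP-polygons; `Vol(Q) ≤ 4k³ + 8k² − 2k` for LDP-polygons;
and `Vol(Q) ≤ 4k³ + 4k² − 2k` for LDP-polygons with `k ≥ 3` prime. -/
theorem volume_bounds_by_maxLocalIndex
    (Q : Set (ℚ × ℚ)) (k : ℤ) (hQ : IsIPPolygon Q) (hk : 2 ≤ k)
    (hmax : HasMaxLocalIndex Q k) :
    nVol Q ≤ 4 * (k : ℝ) ^ 3 + 8 * (k : ℝ) ^ 2 ∧
    (IsLDPPolygon Q → nVol Q ≤ 4 * (k : ℝ) ^ 3 + 8 * (k : ℝ) ^ 2 - 2 * (k : ℝ)) ∧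
    (IsLDPPolygon Q → 3 ≤ k → Prime k →
      nVol Q ≤ 4 * (k : ℝ) ^ 3 + 4 * (k : ℝ) ^ 2 - 2 * (k : ℝ)) := by
  obtain ⟨⟨⟨S, hS⟩, -⟩, h0⟩ := hQ
  obtain ⟨-, hmx⟩ := hmax
  have himg : (fun x : ℚ × ℚ => ((x.1 : ℝ), (x.2 : ℝ))) '' Q ⊆
      convexHull ℝ (vbR '' (S : Set (ℤ × ℤ))) := by
    rintro _ ⟨x, hx, rfl⟩
    rw [hS] at hx
    have hconv : Convex ℚ {x : ℚ × ℚ | (((x.1 : ℝ), (x.2 : ℝ)) : ℝ × ℝ) ∈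
        convexHull ℝ (vbR '' (S : Set (ℤ × ℤ)))} := by
      intro x hx y hy a b ha hb hab
      have := (convex_convexHull ℝ (vbR '' (S : Set (ℤ × ℤ)))) hx hy
        (a := (a : ℝ)) (b := (b : ℝ)) (by exact_mod_cast ha) (by exact_mod_cast hb)
        (by exact_mod_cast hab)
      simpa using this
    refine convexHull_min ?_ hconv hx
    rintro _ ⟨v, hv, rfl⟩
    refine subset_convexHull ℝ _ ⟨v, hv, ?_⟩
    simp [vbR, toQ]
  have hcomp : IsCompact (convexHull ℝ (vbR '' (S : Set (ℤ × ℤ)))) :=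
    (S.finite_toSet.image vbR).isCompact_convexHull ℝ
  have hvol : nVol Q ≤
      2 * (MeasureTheory.volume (convexHull ℝ (vbR '' (S : Set (ℤ × ℤ))))).toReal := by
    unfold nVol
    have := ENNReal.toReal_mono hcomp.measure_lt_top.ne
      (MeasureTheory.measure_mono (μ := MeasureTheory.volume)
        (closure_minimal himg hcomp.isClosed))
    linarith
  -- small axis points lie in the polygon
  have haxis : ∃ e : ℚ, 0 < e ∧ (e, 0) ∈ Q ∧ (-e, 0) ∈ Q ∧ (0, e) ∈ Q ∧ (0, -e) ∈ Q := by
    have hn : Q ∈ nhds (0 : ℚ × ℚ) := mem_interior_iff_mem_nhds.mp h0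
    obtain ⟨δ, hδ, hball⟩ := Metric.mem_nhds_iff.mp hn
    obtain ⟨e, he0, heδ⟩ := exists_rat_btwn hδ
    have he0' : 0 < e := by exact_mod_cast he0
    have hd : ∀ x : ℚ × ℚ, |x.1| ≤ e → |x.2| ≤ e → x ∈ Q := by
      intro x h1 h2
      apply hball
      rw [Metric.mem_ball, Prod.dist_eq, max_lt_iff, Rat.dist_eq, Rat.dist_eq]
      have h1' : |(x.1 : ℝ)| ≤ e := by exact_mod_cast h1
      have h2' : |(x.2 : ℝ)| ≤ e := by exact_mod_cast h2
      simp only [Prod.fst_zero, Prod.snd_zero, Rat.cast_zero, sub_zero]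
      exact ⟨by linarith, by linarith⟩
    have habs : |e| ≤ e := (abs_of_pos he0').le
    refine ⟨e, he0', ?_, ?_, ?_, ?_⟩ <;> apply hd <;> simp [habs, he0'.le]
  obtain ⟨e, he, a1, a2, a3, a4⟩ := haxis
  have hcore := vb_core S k (e : ℝ) (by exact_mod_cast he)
    (himg ⟨_, a1, by simp⟩) (himg ⟨_, a2, by simp⟩) (himg ⟨_, a3, by simp⟩)
    (himg ⟨_, a4, by simp⟩) (by
      intro η l v w hg hl hηS hv hw hvw hηv hηw
      have hQv : ∀ s ∈ S, toQ s ∈ Q := by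
        intro s hs; rw [hS]; exact subset_convexHull ℚ _ ⟨s, hs, rfl⟩
      refine hmx {x ∈ Q | pairQ η x = (l : ℚ)} η l ⟨hg, hl, ?_, rfl, toQ v, ⟨hQv v hv, ?_⟩,
        toQ w, ⟨hQv w hw, ?_⟩, ?_⟩
      · intro y hy
        rw [hS] at hy
        have hconv : Convex ℚ {x : ℚ × ℚ | pairQ η x ≤ (l : ℚ)} := by
          intro x hx y hy p q hp hq hpq
          simp only [Set.mem_ofPred_eq, pairQ, Prod.fst_add, Prod.snd_add, Prod.smul_fst,
            Prod.smul_snd, smul_eq_mul] at *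
          have : p * (l : ℚ) + q * l = l := by rw [← add_mul, hpq, one_mul]
          nlinarith [mul_le_mul_of_nonneg_left hx hp, mul_le_mul_of_nonneg_left hy hq]
        refine convexHull_min ?_ hconv hy
        rintro _ ⟨s, hs, rfl⟩
        have := hηS s hs
        simp only [Set.mem_ofPred_eq, pairQ, toQ]
        exact_mod_cast this
      · simp only [pairQ, toQ]; exact_mod_cast hηv
      · simp only [pairQ, toQ]; exact_mod_cast hηw
      · intro h
        apply hvw
        simp only [toQ, Prod.mk.injEq, Int.cast_inj] at h
        exact Prod.ext h.1 h.2)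
  have hkr : (2 : ℝ) ≤ k := by exact_mod_cast hk
  have hb : nVol Q ≤ 2 * (k : ℝ) * (k + 1) ^ 2 ∨ nVol Q ≤ 32 / 3 * (k : ℝ) ^ 2 :=
    hcore.imp hvol.trans hvol.trans
  refine ⟨?_, fun _ => ?_, fun _ hk3 _ => ?_⟩
  · rcases hb with h | h <;> nlinarith [mul_nonneg (sub_nonneg.mpr hkr) (sq_nonneg (k : ℝ))]
  · rcases hb with h | h <;> nlinarith [mul_nonneg (sub_nonneg.mpr hkr) (sq_nonneg (k : ℝ))]
  · have hkr3 : (3 : ℝ) ≤ k := by exact_mod_cast hk3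
    rcases hb with h | h <;> nlinarith [mul_nonneg (sub_nonneg.mpr hkr3) (sq_nonneg (k : ℝ))]
end

section
/- Let Q be an LDP-polygon with maximal local index m_Q ≥ 2. Then the number of vertices of Q satisfies |V(Q)| ≤ 4·m_Q + 1. -/
open Pointwise

lemma extreme_between {Q : Set (ℚ × ℚ)} {r P T : ℚ × ℚ} (hr : r ∈ vertices Q)
    (hP : P ∈ Q) (hT : T ∈ Q) (a b e1 e2 : ℚ) (hdet : e1 * b - e2 * a = 1)
    (h1 : e1 * P.1 + e2 * P.2 = e1 * r.1 + e2 * r.2)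
    (h2 : e1 * T.1 + e2 * T.2 = e1 * r.1 + e2 * r.2)
    (h3 : a * P.1 + b * P.2 ≤ a * r.1 + b * r.2)
    (h4 : a * r.1 + b * r.2 < a * T.1 + b * T.2) : P = r := by
  obtain ⟨r1, r2⟩ := r
  obtain ⟨p1, p2⟩ := P
  obtain ⟨t1, t2⟩ := T
  simp only at h1 h2 h3 h4
  have inj : ∀ x y : ℚ, e1 * x + e2 * y = 0 → a * x + b * y = 0 → x = 0 ∧ y = 0 := by
    intro x y hx hy
    constructor
    · linear_combination b * hx - e2 * hy - x * hdet
    · linear_combination e1 * hy - a * hx - y * hdet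
  rcases h3.eq_or_lt with h | h
  · have := inj (p1 - r1) (p2 - r2) (by linarith) (by linarith)
    ext <;> simp <;> linarith
  · have hr' := (mem_extremePoints.1 hr).2 _ hP _ hT
    refine (hr' ?_).1
    set D := (a * t1 + b * t2) - (a * p1 + b * p2) with hD
    have hDpos : 0 < D := by linarith
    refine ⟨((a * t1 + b * t2) - (a * r1 + b * r2)) / D,
      ((a * r1 + b * r2) - (a * p1 + b * p2)) / D, div_pos (by linarith) hDpos,
      div_pos (by linarith) hDpos, ?_, ?_⟩
    · rw [← add_div, div_eq_one_iff_eq hDpos.ne']; rw [hD]; ring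
    · set A := ((a * t1 + b * t2) - (a * r1 + b * r2)) / D with hA
      set B := ((a * r1 + b * r2) - (a * p1 + b * p2)) / D with hB
      have hA' : A * D = ((a * t1 + b * t2) - (a * r1 + b * r2)) := by
        rw [hA]; field_simp
      have hB' : B * D = ((a * r1 + b * r2) - (a * p1 + b * p2)) := by
        rw [hB]; field_simp
      have hAB : A + B = 1 := by
        have : (A + B) * D = 1 * D := by rw [add_mul, hA', hB', hD]; ring
        exact mul_right_cancel₀ hDpos.ne' this
      have hBA : B = 1 - A := by linarith
      have key := inj (A * p1 + B * t1 - r1) (A * p2 + B * t2 - r2)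
        (by rw [hBA]; linear_combination A * h1 + (1 - A) * h2)
        (by
          rw [hBA]
          rw [hD] at hA'
          linear_combination -hA')
      ext <;> simp <;> linarith [key.1, key.2]

/-- Levels of a finite set: at most two per level, bounded by `l`, nonnegative sum. -/
lemma level_count (V : Finset (ℤ × ℤ)) (f : ℤ × ℤ → ℤ) (l k : ℤ) (hl : 0 < l) (hlk : l ≤ k)
    (hf : ∀ v ∈ V, f v ≤ l) (hfib : ∀ i, (V.filter (fun v => f v = i)).card ≤ 2)
    (hsum : 0 ≤ ∑ v ∈ V, f v) (hcard : 4 * k + 2 ≤ (V.card : ℤ)) :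
    ∀ i, -k ≤ i → i ≤ k → (V.filter (fun v => f v = i)).card = 2 := by
  have h1 : (l + 1) * (V.card : ℤ) ≤ ∑ v ∈ V, (f v + l + 1) := by
    simp only [Finset.sum_add_distrib, Finset.sum_const, nsmul_eq_mul]
    linarith
  have h2 : ∑ v ∈ V, (f v + l + 1) ≤ ∑ v ∈ V.filter (fun v => -l ≤ f v), (f v + l + 1) := by
    rw [← Finset.sum_filter_add_sum_filter_not V (fun v => -l ≤ f v)]
    have : ∑ v ∈ V.filter (fun v => ¬ -l ≤ f v), (f v + l + 1) ≤ 0 := by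
      apply Finset.sum_nonpos
      intro v hv
      have := (Finset.mem_filter.1 hv).2
      omega
    linarith
  have h3 : ∑ v ∈ V.filter (fun v => -l ≤ f v), (f v + l + 1)
      = ∑ i ∈ Finset.Icc (-l) l, ((V.filter (fun v => f v = i)).card : ℤ) * (i + l + 1) := by
    rw [← Finset.sum_fiberwise_of_maps_to (t := Finset.Icc (-l) l) (g := f)]
    · apply Finset.sum_congr rfl
      intro i hi
      have hi' := Finset.mem_Icc.1 hi
      have : (V.filter (fun v => -l ≤ f v)).filter (fun v => f v = i)
          = V.filter (fun v => f v = i) := by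
        ext v
        simp only [Finset.mem_filter]
        constructor
        · rintro ⟨⟨a, b⟩, c⟩; exact ⟨a, c⟩
        · rintro ⟨a, c⟩; exact ⟨⟨a, by omega⟩, c⟩
      rw [this, ← nsmul_eq_mul, ← Finset.sum_const]
      apply Finset.sum_congr rfl
      intro v hv
      rw [(Finset.mem_filter.1 hv).2]
    · intro v hv
      have hv' := Finset.mem_filter.1 hv
      exact Finset.mem_Icc.2 ⟨hv'.2, hf v hv'.1⟩
  have h4 : ∑ i ∈ Finset.Icc (-l) l, 2 * (i + l + 1) = (2 * l + 1) * (2 * l + 2) := by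
    have : ∀ n : ℕ, ∑ i ∈ Finset.Icc (-l) (-l + n), 2 * (i + l + 1)
        = ((n : ℤ) + 1) * (n + 2) := by
      intro n
      induction n with
      | zero => simp
      | succ n ih =>
        have : Finset.Icc (-l) (-l + ((n + 1 : ℕ) : ℤ))
            = insert (-l + ((n + 1 : ℕ) : ℤ)) (Finset.Icc (-l) (-l + n)) := by
          ext i
          simp only [Finset.mem_Icc, Finset.mem_insert]
          push_cast
          omega
        rw [this, Finset.sum_insert (by simp), ih]
        push_cast
        ring
    have h := this (2 * l).toNat
    rw [Int.toNat_of_nonneg (by omega)] at h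
    rw [← h]
    congr 2
    ring
  have hle : ∀ i ∈ Finset.Icc (-l) l,
      ((V.filter (fun v => f v = i)).card : ℤ) * (i + l + 1) ≤ 2 * (i + l + 1) := by
    intro i hi
    have hi' := Finset.mem_Icc.1 hi
    apply mul_le_mul_of_nonneg_right
    · exact_mod_cast hfib i
    · omega
  have h5 := Finset.sum_le_sum hle
  have h6 : (V.card : ℤ) ≤ 4 * l + 2 := by
    have : (l + 1) * (V.card : ℤ) ≤ (l + 1) * (4 * l + 2) := by
      rw [h4] at h5; nlinarith
    exact le_of_mul_le_mul_left this (by omega)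
  have hlk' : l = k := by omega
  have heq : ∑ i ∈ Finset.Icc (-l) l, ((V.filter (fun v => f v = i)).card : ℤ) * (i + l + 1)
      = ∑ i ∈ Finset.Icc (-l) l, 2 * (i + l + 1) := by
    apply le_antisymm h5
    rw [h4]
    have : (l + 1) * (4 * l + 2) ≤ (l + 1) * (V.card : ℤ) :=
      mul_le_mul_of_nonneg_left (by omega) (by omega)
    nlinarith
  have h7 := (Finset.sum_eq_sum_iff_of_le hle).1 heq
  intro i hi1 hi2
  have h8 := h7 i (Finset.mem_Icc.2 ⟨by omega, by omega⟩)
  have := mul_right_cancel₀ (by omega : i + l + 1 ≠ 0) h8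
  exact_mod_cast this

lemma halfspace_hull (S : Finset (ℤ × ℤ)) (a b c : ℚ)
    (h : ∀ p ∈ S, a * (p.1 : ℚ) + b * p.2 ≤ c) :
    ∀ y ∈ convexHull ℚ (toQ '' (S : Set (ℤ × ℤ))), a * y.1 + b * y.2 ≤ c := by
  have hc : Convex ℚ {y : ℚ × ℚ | a * y.1 + b * y.2 ≤ c} := by
    intro x hx y hy s t hs ht hst
    simp only [Set.mem_ofPred_eq, Prod.fst_add, Prod.snd_add, Prod.smul_fst, Prod.smul_snd,
      smul_eq_mul] at *
    have e : c = s * c + t * c := by rw [← add_mul, hst, one_mul]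
    rw [e]
    nlinarith [mul_le_mul_of_nonneg_left hx hs, mul_le_mul_of_nonneg_left hy ht]
  intro y hy
  refine convexHull_min ?_ hc hy
  rintro _ ⟨p, hp, rfl⟩
  exact h p hp

lemma interior_pos (Q : Set (ℚ × ℚ)) (h0 : (0 : ℚ × ℚ) ∈ interior Q) (a b c : ℚ)
    (hab : a ≠ 0 ∨ b ≠ 0) (h : ∀ y ∈ Q, a * y.1 + b * y.2 ≤ c) : 0 < c := by
  have hQ : Q ∈ nhds (0 : ℚ × ℚ) := mem_interior_iff_mem_nhds.1 h0
  have hcont : Filter.Tendsto (fun t : ℚ => ((t * a, t * b) : ℚ × ℚ)) (nhds 0) (nhds 0) := by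
    have : Continuous (fun t : ℚ => ((t * a, t * b) : ℚ × ℚ)) := by fun_prop
    have h := this.tendsto 0
    simp only [zero_mul] at h
    exact h
  have hev := hcont hQ
  obtain ⟨ε, hε, hball⟩ := Metric.mem_nhds_iff.1 hev
  obtain ⟨t, ht0, htε⟩ := exists_rat_btwn hε
  have ht0' : 0 < t := by exact_mod_cast ht0
  have hmem : t ∈ Metric.ball (0 : ℚ) ε := by
    rw [Metric.mem_ball, Rat.dist_eq]
    simp only [Rat.cast_zero, sub_zero]
    rw [abs_of_pos ht0]; exact htε
  have := h _ (hball hmem)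
  simp only at this
  have hpos : 0 < a * a + b * b := by
    rcases hab with h | h
    · have := mul_self_pos.2 h; nlinarith [mul_self_nonneg b]
    · have := mul_self_pos.2 h; nlinarith [mul_self_nonneg a]
  nlinarith [mul_pos ht0' hpos]

/-- Existence of a facet met by the ray through a nonzero `s`. -/
lemma exists_facet (S : Finset (ℤ × ℤ)) (Q : Set (ℚ × ℚ))
    (hQ : Q = convexHull ℚ (toQ '' (S : Set (ℤ × ℤ)))) (h0 : (0 : ℚ × ℚ) ∈ interior Q)
    (s : ℤ × ℤ) (hs : s ≠ 0) :
    ∃ F η l, IsFacetWith Q η l F ∧ 0 ≤ η.1 * s.1 + η.2 * s.2 := by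
  classical
  obtain ⟨s1, s2⟩ := s
  have hs' : s1 ≠ 0 ∨ s2 ≠ 0 := by
    by_contra hcon
    push Not at hcon
    exact hs (by ext <;> simp [hcon.1, hcon.2])
  have hn : 0 < s1 * s1 + s2 * s2 := by
    rcases hs' with h | h
    · have := mul_self_pos.2 h; nlinarith [mul_self_nonneg s2]
    · have := mul_self_pos.2 h; nlinarith [mul_self_nonneg s1]
  have hhalf : ∀ a b c : ℤ, (a ≠ 0 ∨ b ≠ 0) → (∀ p ∈ S, a * p.1 + b * p.2 ≤ c) → 0 < c := by
    intro a b c hab h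
    have := interior_pos Q h0 a b c (by exact_mod_cast hab)
      (by rw [hQ]; exact halfspace_hull S a b c (fun p hp => by exact_mod_cast h p hp))
    exact_mod_cast this
  set X : ℤ × ℤ → ℤ := fun v => s1 * v.2 - s2 * v.1 with hX
  set Y : ℤ × ℤ → ℤ := fun v => s1 * v.1 + s2 * v.2 with hY
  set Neg := S.filter (fun v => X v ≤ 0) with hNeg
  set Pos := S.filter (fun v => 0 < X v) with hPos
  have hPne : Pos.Nonempty := by
    by_contra hcon
    rw [Finset.not_nonempty_iff_eq_empty, Finset.filter_eq_empty_iff] at hcon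
    have := hhalf (-s2) s1 0 (by rcases hs' with h | h <;> simp [h]) (fun p hp => by
      have := hcon hp; simp only [hX] at this; linarith)
    omega
  have hNne : Neg.Nonempty := by
    by_contra hcon
    rw [Finset.not_nonempty_iff_eq_empty, Finset.filter_eq_empty_iff] at hcon
    have := hhalf (s2) (-s1) 0 (by rcases hs' with h | h <;> simp [h]) (fun p hp => by
      have := hcon hp; simp only [hX] at this; linarith)
    omega
  obtain ⟨⟨p, q0⟩, hpq, hmaxh⟩ := Finset.exists_max_image (Neg ×ˢ Pos)
    (fun z => ((Y z.1 : ℚ) * X z.2 - Y z.2 * X z.1) / ((X z.2 : ℚ) - X z.1))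
    (hNne.product hPne)
  obtain ⟨hp, hq0⟩ := Finset.mem_product.1 hpq
  simp only at hp hq0 hmaxh
  set c : ℚ := ((Y p : ℚ) * X q0 - Y q0 * X p) / ((X q0 : ℚ) - X p) with hc
  obtain ⟨q, hq, hmaxs⟩ := Finset.exists_max_image Pos (fun z => ((Y z : ℚ) - c) / X z) hPne
  set m : ℚ := ((Y q : ℚ) - c) / X q with hm
  have hXp : (X p : ℚ) ≤ 0 := by exact_mod_cast (Finset.mem_filter.1 hp).2
  have hXq0 : (0 : ℚ) < X q0 := by exact_mod_cast (Finset.mem_filter.1 hq0).2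
  have hXq : (0 : ℚ) < X q := by exact_mod_cast (Finset.mem_filter.1 hq).2
  have hqline : (Y q : ℚ) = c + m * X q := by rw [hm]; field_simp; ring
  have hposle : ∀ r ∈ Pos, (Y r : ℚ) ≤ c + m * X r := by
    intro r hr
    have hXr : (0 : ℚ) < X r := by exact_mod_cast (Finset.mem_filter.1 hr).2
    have := hmaxs r hr
    rw [div_le_iff₀ hXr] at this
    linarith
  have hnegle : ∀ r ∈ Neg, (Y r : ℚ) ≤ c + m * X r := by
    intro r hr
    have hXr : (X r : ℚ) ≤ 0 := by exact_mod_cast (Finset.mem_filter.1 hr).2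
    have := hmaxh (r, q) (Finset.mem_product.2 ⟨hr, hq⟩)
    simp only at this
    rw [div_le_iff₀ (by linarith), hqline] at this
    have h : (Y r : ℚ) * X q ≤ (c + m * X r) * X q := by linarith
    exact le_of_mul_le_mul_right h hXq
  have hpline : (Y p : ℚ) = c + m * X p := by
    apply le_antisymm (hnegle p hp)
    have h1 : (Y p : ℚ) * X q0 - Y q0 * X p = c * ((X q0 : ℚ) - X p) := by
      have hne : (X q0 : ℚ) - X p ≠ 0 := by linarith
      rw [hc, div_mul_cancel₀ _ hne]
    have h2 := hposle q0 hq0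
    have h3 := mul_le_mul_of_nonpos_right h2 hXp
    have h : (c + m * X p) * X q0 ≤ (Y p : ℚ) * X q0 := by linarith
    exact le_of_mul_le_mul_right h hXq0
  have hall : ∀ r ∈ S, (Y r : ℚ) ≤ c + m * X r := by
    intro r hr
    by_cases h : X r ≤ 0
    · exact hnegle r (Finset.mem_filter.2 ⟨hr, h⟩)
    · exact hposle r (Finset.mem_filter.2 ⟨hr, not_le.1 h⟩)
  have hD : 0 < X q - X p := by
    have : (0 : ℚ) < X q - X p := by linarith
    exact_mod_cast this
  set D := X q - X p with hDdef
  set E := Y q - Y p with hEdef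
  have hE : (E : ℚ) = m * D := by
    rw [hEdef, hDdef]; push_cast; rw [hqline, hpline]; ring
  -- the integral functional
  set w1 : ℤ := D * s1 + E * s2 with hw1
  set w2 : ℤ := D * s2 - E * s1 with hw2
  have hwv : ∀ v : ℤ × ℤ, w1 * v.1 + w2 * v.2 = D * Y v - E * X v := by
    intro v; simp only [hw1, hw2, hX, hY]; ring
  have hwle : ∀ r ∈ S, w1 * r.1 + w2 * r.2 ≤ w1 * p.1 + w2 * p.2 := by
    intro r hr
    rw [hwv, hwv]
    have hD' : (0 : ℚ) < D := by exact_mod_cast hD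
    have : (D : ℚ) * Y r - E * X r ≤ D * Y p - E * X p := by
      rw [hE, hpline]
      nlinarith [mul_le_mul_of_nonneg_left (hall r hr) hD'.le]
    exact_mod_cast this
  have hwpq : w1 * q.1 + w2 * q.2 = w1 * p.1 + w2 * p.2 := by
    rw [hwv, hwv, hDdef, hEdef]; ring
  have hws : 0 < w1 * s1 + w2 * s2 := by
    have : w1 * s1 + w2 * s2 = D * (s1 * s1 + s2 * s2) := by rw [hw1, hw2]; ring
    rw [this]; exact mul_pos hD hn
  have hwne : w1 ≠ 0 ∨ w2 ≠ 0 := by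
    by_contra hcon
    push Not at hcon
    rw [hcon.1, hcon.2] at hws
    simp at hws
  have hgpos : 0 < Int.gcd w1 w2 := Int.gcd_pos_iff.2 hwne
  obtain ⟨η1, η2, hcop, he1, he2⟩ := Int.exists_gcd_one hgpos
  set g : ℤ := (Int.gcd w1 w2 : ℤ) with hg
  have hg0 : 0 < g := by rw [hg]; exact_mod_cast hgpos
  have hηw : ∀ v : ℤ × ℤ, w1 * v.1 + w2 * v.2 = (η1 * v.1 + η2 * v.2) * g := by
    intro v; rw [he1, he2]; ring
  have hpS : p ∈ S := (Finset.mem_filter.1 hp).1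
  have hqS : q ∈ S := (Finset.mem_filter.1 hq).1
  have hηle : ∀ r ∈ S, η1 * r.1 + η2 * r.2 ≤ η1 * p.1 + η2 * p.2 := by
    intro r hr
    have := hwle r hr
    rw [hηw, hηw] at this
    exact le_of_mul_le_mul_right this hg0
  have hηpq : η1 * q.1 + η2 * q.2 = η1 * p.1 + η2 * p.2 := by
    have := hwpq
    rw [hηw, hηw] at this
    exact mul_right_cancel₀ hg0.ne' this
  have hηne : η1 ≠ 0 ∨ η2 ≠ 0 := by
    by_contra hcon
    push Not at hcon
    rw [hcon.1, hcon.2] at hcop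
    simp at hcop
  have hmem : ∀ r ∈ S, toQ r ∈ Q := by
    intro r hr; rw [hQ]; exact subset_convexHull _ _ ⟨r, hr, rfl⟩
  refine ⟨_, (η1, η2), η1 * p.1 + η2 * p.2, ⟨hcop, hhalf η1 η2 _ hηne hηle, ?_, rfl, ?_⟩, ?_⟩
  · rw [hQ]
    exact halfspace_hull S η1 η2 _ (fun r hr => by exact_mod_cast hηle r hr)
  · refine ⟨toQ p, ⟨hmem p hpS, by simp [pairQ, toQ]⟩, toQ q, ⟨hmem q hqS, ?_⟩, ?_⟩
    · simp only [pairQ, toQ]; exact_mod_cast hηpq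
    · intro h
      have h1 : p = q := by
        simp only [toQ, Prod.mk.injEq, Int.cast_inj] at h
        exact Prod.ext h.1 h.2
      rw [hDdef, h1] at hD
      simp at hD
  · have := hηw (s1, s2)
    simp only at this
    rw [this] at hws
    exact (pos_of_mul_pos_left hws hg0.le).le

/-- An LDP-polygon of maximal local index `m_Q ≥ 2` has at most `4·m_Q + 1`
vertices. -/
theorem vertex_number_bound
    (Q : Set (ℚ × ℚ)) (k : ℤ) (hQ : IsLDPPolygon Q) (hk : 2 ≤ k)
    (hmax : HasMaxLocalIndex Q k) :
    ((vertices Q).ncard : ℤ) ≤ 4 * k + 1 := by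
  classical
  obtain ⟨⟨⟨⟨S, hS⟩, -⟩, h0⟩, hprim⟩ := hQ
  have htoQ : Function.Injective toQ := by
    intro a b h
    simp only [toQ, Prod.mk.injEq, Int.cast_inj] at h
    exact Prod.ext h.1 h.2
  have hconv : Convex ℚ Q := by rw [hS]; exact convex_convexHull _ _
  set V := S.filter (fun v => toQ v ∈ vertices Q) with hV
  have hvV : vertices Q = toQ '' (V : Set (ℤ × ℤ)) := by
    ext x
    constructor
    · intro hx
      have : x ∈ toQ '' (S : Set (ℤ × ℤ)) := by
        apply extremePoints_convexHull_subset (𝕜 := ℚ)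
        rw [← hS]; exact hx
      obtain ⟨v, hv, rfl⟩ := this
      exact ⟨v, by simpa [hV] using ⟨hv, hx⟩, rfl⟩
    · rintro ⟨v, hv, rfl⟩
      exact (Finset.mem_filter.1 (Finset.mem_coe.1 hv)).2
  have hVext : ∀ v ∈ V, toQ v ∈ vertices Q := fun v hv => (Finset.mem_filter.1 hv).2
  have hVQ : ∀ v ∈ V, toQ v ∈ Q := fun v hv => (hVext v hv).1
  have hVprim : ∀ v ∈ V, Int.gcd v.1 v.2 = 1 := by
    intro v hv
    obtain ⟨p, hp, hpv⟩ := hprim _ (hVext v hv)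
    rw [htoQ hpv]; exact hp
  have hcardV : (vertices Q).ncard = V.card := by
    rw [hvV, Set.ncard_image_of_injective _ htoQ, Set.ncard_coe_finset]
  rw [hcardV]
  by_contra hcon
  have hcard : 4 * k + 2 ≤ (V.card : ℤ) := by omega
  -- special facet
  have hspecial : ∃ F η l, IsFacetWith Q η l F ∧
      0 ≤ η.1 * (∑ v ∈ V, v).1 + η.2 * (∑ v ∈ V, v).2 := by
    by_cases hs : (∑ v ∈ V, v) = 0
    · obtain ⟨F, η, hF⟩ := hmax.1
      exact ⟨F, η, k, hF, by rw [hs]; simp⟩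
    · exact exists_facet S Q hS h0 _ hs
  obtain ⟨F, ⟨η1, η2⟩, l, hF, hsum⟩ := hspecial
  have hlk := hmax.2 _ _ _ hF
  obtain ⟨hcop, hl, hle, -, -⟩ := hF
  simp only at hcop hsum
  -- complementary coordinate
  obtain ⟨a, b, hab⟩ : ∃ a b : ℤ, η1 * b - η2 * a = 1 := by
    have h := Int.gcd_eq_gcd_ab η1 η2
    rw [hcop] at h
    exact ⟨-Int.gcdB η1 η2, Int.gcdA η1 η2, by push_cast at h; linarith⟩
  set f : ℤ × ℤ → ℤ := fun v => η1 * v.1 + η2 * v.2 with hf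
  set g : ℤ × ℤ → ℤ := fun v => a * v.1 + b * v.2 with hg
  have hinj : ∀ u v : ℤ × ℤ, f u = f v → g u = g v → u = v := by
    intro u v h1 h2
    simp only [hf, hg] at h1 h2
    ext
    · linear_combination b * h1 - η2 * h2 - (u.1 - v.1) * hab
    · linear_combination η1 * h2 - a * h1 - (u.2 - v.2) * hab
  have habQ : (η1 : ℚ) * b - η2 * a = 1 := by exact_mod_cast hab
  have habQ' : (-η1 : ℚ) * (-b) - (-η2) * (-a) = 1 := by linarith
  have hbet : ∀ u ∈ V, ∀ v ∈ V, ∀ w ∈ V, f u = f v → f w = f v → g u < g v → g v < g w →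
      False := by
    intro u hu v hv w hw h1 h2 h3 h4
    have := extreme_between (hVext v hv) (hVQ u hu) (hVQ w hw) a b η1 η2 habQ
      (by simp only [toQ]; exact_mod_cast h1) (by simp only [toQ]; exact_mod_cast h2)
      (by simp only [toQ]; exact_mod_cast h3.le) (by simp only [toQ]; exact_mod_cast h4)
    rw [htoQ this] at h3
    exact lt_irrefl _ h3
  have hfib : ∀ i, (V.filter (fun v => f v = i)).card ≤ 2 := by
    intro i
    by_contra hc
    obtain ⟨u, v, w, hu, hv, hw, huv, huw, hvw⟩ := Finset.two_lt_card_iff.1 (not_le.1 hc)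
    obtain ⟨hu, hu'⟩ := Finset.mem_filter.1 hu
    obtain ⟨hv, hv'⟩ := Finset.mem_filter.1 hv
    obtain ⟨hw, hw'⟩ := Finset.mem_filter.1 hw
    have e1 : f u = f v := by omega
    have e2 : f u = f w := by omega
    have e3 : f v = f w := by omega
    have n1 : g u ≠ g v := fun h => huv (hinj _ _ e1 h)
    have n2 : g u ≠ g w := fun h => huw (hinj _ _ e2 h)
    have n3 : g v ≠ g w := fun h => hvw (hinj _ _ e3 h)
    rcases lt_or_gt_of_ne n1 with h1 | h1 <;> rcases lt_or_gt_of_ne n2 with h2 | h2 <;>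
      rcases lt_or_gt_of_ne n3 with h3 | h3
    · exact hbet u hu v hv w hw e1 e3.symm h1 h3
    · exact hbet u hu w hw v hv e2 e3 h2 h3
    · omega
    · exact hbet w hw u hu v hv e2.symm e1.symm h2 h1
    · exact hbet v hv u hu w hw e1.symm e2.symm h1 h2
    · omega
    · exact hbet v hv w hw u hu e3 e2 h3 h2
    · exact hbet w hw v hv u hu e3.symm e1 h3 h1
  have hfle : ∀ v ∈ V, f v ≤ l := by
    intro v hv
    have := hle _ (hVQ v hv)
    simp only [pairQ, toQ] at this
    exact_mod_cast this
  have hfsum : 0 ≤ ∑ v ∈ V, f v := by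
    have : ∑ v ∈ V, f v = η1 * (∑ v ∈ V, v).1 + η2 * (∑ v ∈ V, v).2 := by
      simp only [hf, Finset.sum_add_distrib, Prod.fst_sum, Prod.snd_sum, Finset.mul_sum]
    rw [this]; exact hsum
  have hlev := level_count V f l k hl hlk hfle hfib hfsum hcard
  -- two ordered vertices on each level
  have hpair : ∀ i, -k ≤ i → i ≤ k →
      ∃ u ∈ V, ∃ v ∈ V, f u = i ∧ f v = i ∧ g u < g v := by
    intro i h1 h2
    obtain ⟨u, v, huv, he⟩ := Finset.card_eq_two.1 (hlev i h1 h2)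
    have hu : u ∈ V.filter (fun v => f v = i) := by rw [he]; simp
    have hv : v ∈ V.filter (fun v => f v = i) := by rw [he]; simp
    obtain ⟨hu, hu'⟩ := Finset.mem_filter.1 hu
    obtain ⟨hv, hv'⟩ := Finset.mem_filter.1 hv
    have n : g u ≠ g v := fun h => huv (hinj _ _ (by omega) h)
    rcases lt_or_gt_of_ne n with h | h
    · exact ⟨u, hu, v, hv, hu', hv', h⟩
    · exact ⟨v, hv, u, hu, hv', hu', h⟩
  have hmid : ∀ p ∈ V, ∀ q ∈ V, (1 / 2 : ℚ) • toQ p + (1 / 2 : ℚ) • toQ q ∈ Q := by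
    intro p hp q hq
    exact hconv (hVQ p hp) (hVQ q hq) (by norm_num) (by norm_num) (by norm_num)
  have hmidne : ∀ p ∈ V, ∀ q ∈ V, ∀ r ∈ V, f p ≠ f r →
      (1 / 2 : ℚ) • toQ p + (1 / 2 : ℚ) • toQ q ≠ toQ r := by
    intro p hp q hq r hr hne he
    have := (mem_extremePoints.1 (hVext r hr)).2 _ (hVQ p hp) _ (hVQ q hq)
      ⟨1 / 2, 1 / 2, by norm_num, by norm_num, by norm_num, he⟩
    exact hne (by rw [htoQ this.1])
  have hleft : ∀ p ∈ V, ∀ q ∈ V, ∀ r ∈ V, ∀ s ∈ V, f p ≠ f r → f p + f q = 2 * f r →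
      f s = f r → g r < g s → 2 * g r < g p + g q := by
    intro p hp q hq r hr s hs h1 h2 h3 h4
    by_contra h5
    push Not at h5
    have h2' : ((f p : ℤ) : ℚ) + f q = 2 * f r := by exact_mod_cast h2
    have h5' : ((g p : ℤ) : ℚ) + g q ≤ 2 * g r := by exact_mod_cast h5
    simp only [hf, hg] at h2' h5'
    push_cast at h2' h5'
    refine hmidne p hp q hq r hr h1 (extreme_between (hVext r hr) (hmid p hp q hq) (hVQ s hs)
      a b η1 η2 habQ ?_ (by simp only [toQ]; exact_mod_cast h3) ?_
      (by simp only [toQ]; exact_mod_cast h4))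
    · simp [toQ]; linarith
    · simp [toQ]; linarith
  have hright : ∀ p ∈ V, ∀ q ∈ V, ∀ r ∈ V, ∀ s ∈ V, f p ≠ f r → f p + f q = 2 * f r →
      f s = f r → g s < g r → g p + g q < 2 * g r := by
    intro p hp q hq r hr s hs h1 h2 h3 h4
    by_contra h5
    push Not at h5
    have h2' : ((f p : ℤ) : ℚ) + f q = 2 * f r := by exact_mod_cast h2
    have h3' : ((f s : ℤ) : ℚ) = f r := by exact_mod_cast h3
    have h4' : ((g s : ℤ) : ℚ) < g r := by exact_mod_cast h4
    have h5' : 2 * ((g r : ℤ) : ℚ) ≤ g p + g q := by exact_mod_cast h5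
    simp only [hf, hg] at h2' h3' h4' h5'
    push_cast at h2' h3' h4' h5'
    refine hmidne p hp q hq r hr h1 (extreme_between (hVext r hr) (hmid p hp q hq) (hVQ s hs)
      (-a) (-b) (-η1) (-η2) habQ' ?_ ?_ ?_ ?_)
    · simp [toQ]; linarith
    · simp [toQ]; linarith
    · simp [toQ]; linarith
    · simp [toQ]; linarith
  -- level zero
  have hunit : ∀ v ∈ V, f v = 0 → g v = 1 ∨ g v = -1 := by
    intro v hv h
    have e1 : v.1 = g v * (-η2) := by
      simp only [hf, hg] at h ⊢
      linear_combination b * h - v.1 * hab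
    have e2 : v.2 = g v * η1 := by
      simp only [hf, hg] at h ⊢
      linear_combination -a * h - v.2 * hab
    have hd : g v ∣ (Int.gcd v.1 v.2 : ℤ) := Int.dvd_coe_gcd ⟨_, e1⟩ ⟨_, e2⟩
    rw [hVprim v hv] at hd
    exact Int.isUnit_iff.1 (isUnit_of_dvd_one (by simpa using hd))
  obtain ⟨p0, hp0, q0, hq0, fp0, fq0, h0'⟩ := hpair 0 (by omega) (by omega)
  obtain ⟨p1, hp1, q1, hq1, fp1, fq1, h1'⟩ := hpair 1 (by omega) (by omega)
  obtain ⟨p2, hp2, q2, hq2, fp2, fq2, h2'⟩ := hpair 2 (by omega) (by omega)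
  obtain ⟨r1, hr1, t1, ht1, fr1, ft1, h3'⟩ := hpair (-1) (by omega) (by omega)
  obtain ⟨r2, hr2, t2, ht2, fr2, ft2, h4'⟩ := hpair (-2) (by omega) (by omega)
  have u1 := hunit p0 hp0 fp0
  have u2 := hunit q0 hq0 fq0
  have c1 := hleft p0 hp0 p2 hp2 p1 hp1 q1 hq1 (by omega) (by omega) (by omega) h1'
  have c2 := hright q0 hq0 q2 hq2 q1 hq1 p1 hp1 (by omega) (by omega) (by omega) h1'
  have c3 := hleft p0 hp0 r2 hr2 r1 hr1 t1 ht1 (by omega) (by omega) (by omega) h3'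
  have c4 := hright q0 hq0 t2 ht2 t1 ht1 r1 hr1 (by omega) (by omega) (by omega) h3'
  have c5 := hleft p1 hp1 r1 hr1 p0 hp0 q0 hq0 (by omega) (by omega) (by omega) h0'
  have c6 := hright q1 hq1 t1 ht1 q0 hq0 p0 hp0 (by omega) (by omega) (by omega) h0'
  omega
end
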